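/- arXiv:1401.7931 — 8 statements merged into one kernel-verified Lean document; each statement's English description precedes it below -/
import Mathlib

section
/- Let G be a path-pairable simple graph on n vertices whose diameter d satisfies d ≥ 20. Then d ≤ 6·√2·√n. -/
/-- A simple graph is *path-pairable* if it has an even number of vertices and, for every
partition of its vertex set into unordered pairs (encoded as a fixed-point-free involution
`f`, pairing each vertex `v` with `f v`), there are paths joining each vertex to its pair
such that paths belonging to distinct pairs are pairwise edge-disjoint. -/
def SimpleGraph.PathPairable {V : Type*} (G : SimpleGraph V) : Prop :=
  Even (Nat.card V) ∧
  ∀ f : V → V, Function.Involutive f → (∀ v, f v ≠ v) →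
    ∃ P : (v : V) → G.Walk v (f v),
      (∀ v, (P v).IsPath) ∧
      ∀ v w, w ≠ v → w ≠ f v → ∀ e ∈ (P v).edges, e ∉ (P w).edges

open Finset in
/-- A set containing at most half of the vertices can be matched into its complement. -/
theorem exists_involutive_mapping_into_compl {V : Type*} [Fintype V] [DecidableEq V]
    (heven : Even (Fintype.card V)) (A : Finset V) (hA : 2 * #A ≤ Fintype.card V) :
    ∃ f : V → V, Function.Involutive f ∧ (∀ v, f v ≠ v) ∧ ∀ v ∈ A, f v ∉ A := by
  obtain ⟨m, hm⟩ := heven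
  obtain ⟨B, hAB, hB⟩ := exists_superset_card_eq (s := A) (n := m) (by omega) (by omega)
  have hBc : #B = #Bᶜ := by rw [card_compl]; omega
  let e : B ≃ (Bᶜ : Finset V) := equivOfCardEq hBc
  let f : V → V := fun v =>
    if h : v ∈ B then (e ⟨v, h⟩ : V) else (e.symm ⟨v, mem_compl.2 h⟩ : V)
  have hf_mem (v) (h : v ∈ B) : f v = e ⟨v, h⟩ := dif_pos h
  have hf_notMem (v) (h : v ∉ B) : f v = e.symm ⟨v, mem_compl.2 h⟩ := dif_neg h
  have hf_swap (v) : f v ∈ B ↔ v ∉ B := by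
    by_cases h : v ∈ B
    · simpa [hf_mem v h, h] using mem_compl.1 (e ⟨v, h⟩).2
    · simp [hf_notMem v h, h]
  refine ⟨f, fun v => ?_, fun v hv => ?_, fun v hv hfv => ?_⟩
  · by_cases h : v ∈ B
    · rw [hf_notMem (f v) (by simpa [hf_swap] using h)]
      simp [hf_mem v h]
    · rw [hf_mem (f v) ((hf_swap v).2 h)]
      simp [hf_notMem v h]
  · have := hf_swap v
    rw [hv] at this
    tauto
  · exact (hf_swap v).1 (hAB hfv) (hAB hv)

namespace SimpleGraph

variable {V : Type*} [Fintype V] [DecidableEq V] {G : SimpleGraph V}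

open Finset

/-- In a path-pairable graph, a set `A` of at most half of the vertices has at least `#A` edges
leaving it; here these edges are assumed to run from `S` to `T`. -/
theorem PathPairable.card_le_card_mul_card (hpp : G.PathPairable) {A S T : Finset V}
    (hA : 2 * #A ≤ Fintype.card V)
    (hST : ∀ u ∈ A, ∀ w ∉ A, G.Adj u w → u ∈ S ∧ w ∈ T) : #A ≤ #S * #T := by
  obtain ⟨heven, hpair⟩ := hpp
  rw [Nat.card_eq_fintype_card] at heven
  obtain ⟨f, hf, hfix, hfA⟩ := exists_involutive_mapping_into_compl heven A hA
  obtain ⟨P, -, hP⟩ := hpair f hf hfix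
  have hcross (v : V) : ∃ p : V × V, v ∈ A → p ∈ S ×ˢ T ∧ s(p.1, p.2) ∈ (P v).edges := by
    by_cases hv : v ∈ A
    · obtain ⟨d, hd, hd₁, hd₂⟩ := (P v).exists_boundary_dart A hv (hfA v hv)
      exact ⟨d.toProd, fun _ => ⟨mem_product.2 (hST _ hd₁ _ hd₂ d.adj),
        List.mem_map.2 ⟨d, hd, rfl⟩⟩⟩
    · exact ⟨(v, v), fun h => absurd h hv⟩
  choose g hg using hcross
  rw [← card_product]
  refine card_le_card_of_injOn g (fun v hv => (hg v hv).1) fun v hv w hw hvw => ?_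
  by_contra hne
  refine hP v w (Ne.symm hne) (fun h => hfA v hv (h ▸ hw)) _ (hg v hv).2 ?_
  rw [hvw]
  exact (hg w hw).2

/-- Balls with at most half of the vertices of a path-pairable graph grow quadratically. -/
theorem PathPairable.sq_le_card_ball (hpp : G.PathPairable) (hG : G.Connected) (x : V) (m : ℕ)
    (hm : 2 * #{v | G.dist x v ≤ m} ≤ Fintype.card V) :
    (m + 1) ^ 2 ≤ 16 * #{v | G.dist x v ≤ m} := by
  have hmono {i j : ℕ} (h : i ≤ j) : #{v | G.dist x v ≤ i} ≤ #{v | G.dist x v ≤ j} :=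
    card_le_card fun v hv => by simp only [mem_filter_univ] at hv ⊢; omega
  have hsucc (i : ℕ) : #{v | G.dist x v ≤ i + 1} =
      #{v | G.dist x v ≤ i} + #{v | G.dist x v = i + 1} := by
    rw [← card_union_of_disjoint]
    · congr 1
      ext v
      simp only [mem_filter_univ, mem_union]
      omega
    · exact disjoint_filter.2 fun v _ h₁ h₂ => by omega
  have hpos : 0 < #{v | G.dist x v ≤ 0} := card_pos.2 ⟨x, by simp⟩
  induction m using Nat.twoStepInduction with
  | zero => omega
  | one => have := hmono zero_le_one; omega
  | more i ih₀ ih₁ =>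
    have h₀ := ih₀ (by have := hmono (show i ≤ i + 2 by omega); omega)
    have hhalf : 2 * #{v | G.dist x v ≤ i + 1} ≤ Fintype.card V := by
      have := hmono (show i + 1 ≤ i + 2 by omega)
      omega
    have h₁ := ih₁ hhalf
    have hcut := hpp.card_le_card_mul_card hhalf (S := {v | G.dist x v = i + 1})
      (T := {v | G.dist x v = i + 2}) fun u hu w hw huw => by
        have := hG.dist_triangle (u := x) (v := u) (w := w)
        rw [dist_eq_one_iff_adj.2 huw] at this
        simp only [mem_filter_univ] at hu hw ⊢
        omega
    rw [hsucc (i + 1), hsucc i]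
    generalize #{v | G.dist x v ≤ i + 1} = b at *
    generalize #{v | G.dist x v ≤ i} = a at *
    generalize #{v | G.dist x v = i + 1} = s at *
    generalize #{v | G.dist x v = i + 1 + 1} = t at *
    have hsum : i + 2 ≤ 2 * (s + t) := by
      refine (Nat.pow_le_pow_iff_left two_ne_zero).1 ?_
      zify at *
      nlinarith [sq_nonneg ((s : ℤ) - t)]
    nlinarith

end SimpleGraph

/-- **Theorem.** If `G` is a path-pairable graph on `n` vertices with diameter `d ≥ 20`,
then `d ≤ 6·√2·√n`. -/
theorem diam_le_of_pathPairable {V : Type*} [Fintype V] {G : SimpleGraph V} {n : ℕ}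
    (hn : Fintype.card V = n) (hpp : G.PathPairable) (hd : 20 ≤ G.diam) :
    (G.diam : ℝ) ≤ 6 * Real.sqrt 2 * Real.sqrt n := by
  classical
  have hd₀ : G.diam ≠ 0 := by omega
  have htop : G.ediam ≠ ⊤ := SimpleGraph.ediam_ne_top_of_diam_ne_zero hd₀
  have : Nontrivial V := SimpleGraph.nontrivial_of_diam_ne_zero hd₀
  have hG : G.Connected := SimpleGraph.connected_of_ediam_ne_top htop
  obtain ⟨x, y, hxy⟩ := G.exists_dist_eq_diam
  obtain ⟨m, hm⟩ : ∃ m, m = (G.diam - 1) / 2 := ⟨_, rfl⟩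
  have hdisj : Disjoint ({v | G.dist x v ≤ m} : Finset V) ({v | G.dist y v ≤ m} : Finset V) := by
    refine Finset.disjoint_filter.2 fun v _ hx hy => ?_
    have := hG.dist_triangle (u := x) (v := v) (w := y)
    rw [G.dist_comm (u := v), hxy] at this
    omega
  have hcard := Finset.card_le_univ (({v | G.dist x v ≤ m} : Finset V) ∪ ({v | G.dist y v ≤ m} : Finset V))
  rw [Finset.card_union_of_disjoint hdisj] at hcard
  have hbound : (m + 1) ^ 2 ≤ 8 * n := by
    by_cases hx : 2 * Finset.card ({v | G.dist x v ≤ m} : Finset V) ≤ Fintype.card V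
    · have := hpp.sq_le_card_ball hG x m hx
      omega
    · have := hpp.sq_le_card_ball hG y m (by omega)
      omega
  have hsq : G.diam ^ 2 ≤ 72 * n := by
    have : G.diam ≤ 2 * (m + 1) := by omega
    nlinarith
  rw [mul_assoc, ← Real.sqrt_mul zero_le_two]
  refine le_of_sq_le_sq ?_ (by positivity)
  rw [mul_pow, Real.sq_sqrt (by positivity)]
  have : (G.diam : ℝ) ^ 2 ≤ 72 * n := mod_cast hsq
  linarith
end

section
/- Let G be a path-pairable simple graph on n vertices, let x be a vertex of G, and for i ≥ 0 let s_i denote the number of vertices at graph distance exactly i from x and u_i = s_0 + s_1 + ⋯ + s_i the number of vertices at distance at most i from x. Then for every k ≥ 0, if u_{2k+1} ≤ n/2 then s_{2k} + s_{2k+1} ≥ k. -/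
/-- A set containing at most half of an even number of points can be matched into its complement
by a fixed-point-free involution of the whole type. -/
theorem exists_involutive_mapsTo_compl {V : Type*} [Fintype V] [DecidableEq V]
    (heven : Even (Fintype.card V)) (U : Finset V) (hU : 2 * U.card ≤ Fintype.card V) :
    ∃ f : V → V, Function.Involutive f ∧ (∀ v, f v ≠ v) ∧ ∀ v ∈ U, f v ∉ U := by
  obtain ⟨m, hm⟩ := heven
  obtain ⟨T, hUT, hT⟩ := Finset.exists_superset_card_eq (s := U) (n := m) (by omega) (by omega)
  have hTc : Tᶜ.card = m := by rw [Finset.card_compl]; omega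
  let e : T ≃ (Tᶜ : Finset V) := Finset.equivOfCardEq (hT.trans hTc.symm)
  let f : V → V := fun v =>
    if h : v ∈ T then e ⟨v, h⟩ else e.symm ⟨v, Finset.mem_compl.2 h⟩
  have hf : ∀ v (h : v ∈ T), f v = e ⟨v, h⟩ := fun v h => dif_pos h
  have hf' : ∀ v (h : v ∉ T), f v = e.symm ⟨v, Finset.mem_compl.2 h⟩ := fun v h => dif_neg h
  have hmem : ∀ v ∈ T, f v ∉ T := fun v h => by
    rw [hf v h]; exact Finset.mem_compl.1 (e ⟨v, h⟩).2
  have hmem' : ∀ v, v ∉ T → f v ∈ T := fun v h => by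
    rw [hf' v h]; exact (e.symm ⟨v, Finset.mem_compl.2 h⟩).2
  refine ⟨f, fun v => ?_, fun v hv => ?_, fun v hv h => hmem v (hUT hv) (hUT h)⟩
  · by_cases h : v ∈ T
    · rw [hf' _ (hmem v h)]
      simp only [hf v h, Subtype.coe_eta, Equiv.symm_apply_apply]
    · rw [hf _ (hmem' v h)]
      simp only [hf' v h, Subtype.coe_eta, Equiv.apply_symm_apply]
  · by_cases h : v ∈ T
    · exact hmem v h (hv.symm ▸ h)
    · exact h (hv ▸ hmem' v h)

/-- In a path-pairable graph, if every edge leaving `U` goes from `A` to `B` and `U` contains at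
most half of the vertices, then `U` has at most `|A| * |B|` vertices. -/
theorem SimpleGraph.PathPairable.card_le_mul {V : Type*} [Fintype V] [DecidableEq V]
    {G : SimpleGraph V} (hpp : G.PathPairable) (U A B : Finset V)
    (hU : 2 * U.card ≤ Fintype.card V)
    (hcut : ∀ y ∈ U, ∀ z, z ∉ U → G.Adj y z → y ∈ A ∧ z ∈ B) :
    U.card ≤ A.card * B.card := by
  obtain ⟨heven, hpair⟩ := hpp
  rw [Nat.card_eq_fintype_card] at heven
  obtain ⟨f, hinv, hfix, hfU⟩ := exists_involutive_mapsTo_compl heven U hU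
  obtain ⟨P, -, hdisj⟩ := hpair f hinv hfix
  rw [← Finset.card_product]
  refine Finset.card_le_card_of_forall_subsingleton
    (fun v p => s(p.1, p.2) ∈ (P v).edges) (fun v hv => ?_) ?_
  · obtain ⟨d, hd, hfst, hsnd⟩ := (P v).exists_boundary_dart (U : Set V) hv (hfU v hv)
    exact ⟨d.toProd, Finset.mem_product.2 (hcut _ hfst _ hsnd d.adj), List.mem_map_of_mem hd⟩
  · rintro p - v ⟨hv, hpv⟩ w ⟨hw, hpw⟩
    by_contra hne
    exact hdisj v w (Ne.symm hne) (fun h => hfU v hv (h ▸ hw)) _ hpv hpw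

/-- An edge leaving the ball of radius `i` around `x` joins the layers `i` and `i + 1`. -/
theorem SimpleGraph.Adj.dist_eq_of_dist_le_of_lt_dist {V : Type*} {G : SimpleGraph V} {x y z : V}
    {i : ℕ} (hadj : G.Adj y z) (hy : G.dist x y ≤ i) (hz : i < G.dist x z) :
    G.dist x y = i ∧ G.dist x z = i + 1 := by
  have hxz : G.Reachable x z := SimpleGraph.Reachable.of_dist_ne_zero (by omega)
  obtain ⟨p, hp⟩ := (hxz.trans hadj.symm.reachable).exists_walk_length_eq_dist
  have hle := SimpleGraph.dist_le (p.concat hadj)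
  rw [SimpleGraph.Walk.length_concat, hp] at hle
  omega

/-- **Lemma 1.** In a path-pairable graph on `n` vertices, the distance layers
`s i = |{v : dist x v = i}|` from any vertex `x` satisfy `s (2k) + s (2k+1) ≥ k`
as long as `u (2k+1) = |{v : dist x v ≤ 2k+1}| ≤ n/2`. -/
theorem layers_grow {V : Type*} [Fintype V] {G : SimpleGraph V} {n : ℕ}
    (hn : Fintype.card V = n) (hpp : G.PathPairable) (x : V)
    (s u : ℕ → ℕ)
    (hs : ∀ i, s i = {v : V | G.dist x v = i}.ncard)
    (hu : ∀ i, u i = {v : V | G.dist x v ≤ i}.ncard) :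
    ∀ k : ℕ, 2 * u (2 * k + 1) ≤ n → k ≤ s (2 * k) + s (2 * k + 1) := by
  classical
  have hs' : ∀ i, s i = (Finset.univ.filter fun v => G.dist x v = i).card := fun i => by
    rw [hs, ← Set.ncard_coe_finset]; simp
  have hu' : ∀ i, u i = (Finset.univ.filter fun v => G.dist x v ≤ i).card := fun i => by
    rw [hu, ← Set.ncard_coe_finset]; simp
  have hsucc : ∀ i, u (i + 1) = u i + s (i + 1) := fun i => by
    rw [hu', hu', hs', ← Finset.card_union_of_disjoint]
    · congr 1
      ext v
      simp only [Finset.mem_filter, Finset.mem_univ, true_and, Finset.mem_union]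
      omega
    · refine Finset.disjoint_filter.2 fun v _ h => ?_
      omega
  have hpos : ∀ i, 0 < u i := fun i => by
    rw [hu']
    exact Finset.card_pos.2 ⟨x, by simp⟩
  have hcut : ∀ i, 2 * u i ≤ n → u i ≤ s i * s (i + 1) := fun i hi => by
    rw [hu', hs', hs']
    refine hpp.card_le_mul _ _ _ (by rw [← hu', hn]; exact hi) fun y hy z hz hadj => ?_
    simp only [Finset.mem_filter, Finset.mem_univ, true_and, not_le] at hy hz ⊢
    exact hadj.dist_eq_of_dist_le_of_lt_dist hy hz
  have key : ∀ k, 2 * u (2 * k + 1) ≤ n →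
      k ≤ s (2 * k) + s (2 * k + 1) ∧ k * (k + 1) ≤ 2 * u (2 * k + 1) := by
    intro k
    induction k with
    | zero => simp
    | succ k ih =>
      intro hk
      rw [show 2 * (k + 1) = 2 * k + 1 + 1 by ring] at hk ⊢
      have h₁ := hsucc (2 * k + 1)
      have h₂ := hsucc (2 * k + 1 + 1)
      obtain ⟨-, hsum⟩ := ih (by omega)
      have hprod := hcut (2 * k + 1 + 1) (by omega)
      have hone := hpos (2 * k + 1 + 1)
      have hlayer : k + 1 ≤ s (2 * k + 1 + 1) + s (2 * k + 1 + 1 + 1) := by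
        by_contra! hlt
        generalize s (2 * k + 1 + 1) = a at *
        generalize s (2 * k + 1 + 1 + 1) = b at *
        have hab : (a + b) * (a + b) ≤ k * k := Nat.mul_self_le_mul_self (by omega)
        nlinarith [four_mul_le_sq_add a b]
      exact ⟨hlayer, by nlinarith⟩
  exact fun k hk => (key k hk).1
end

section
/- Let G be a path-pairable simple graph on n vertices with diameter d ≥ 20, and let x and y be vertices of G with d(x,y) = d. Then the set A of vertices at graph distance at most ⌈d/3⌉ from x satisfies |A| ≥ min(n/2, d²/100), and likewise the set C of vertices at graph distance at most ⌈d/3⌉ from y satisfies |C| ≥ min(n/2, d²/100). -/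
open Finset in
/-- In a path-pairable graph, a set `X` of at most half of the vertices has at least `#X` edges
leaving it; hence `#X ≤ #A * #B` whenever all these edges run from `A` to `B`. -/
theorem SimpleGraph.PathPairable.card_le_mul_card {V : Type*} [Fintype V] [DecidableEq V]
    {G : SimpleGraph V} (hG : G.PathPairable) {X A B : Finset V}
    (hX : 2 * #X ≤ Fintype.card V)
    (hAB : ∀ a b, G.Adj a b → a ∈ X → b ∉ X → a ∈ A ∧ b ∈ B) : #X ≤ #A * #B := by
  obtain ⟨hV, hP⟩ := hG
  rw [Nat.card_eq_fintype_card] at hV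
  obtain ⟨m, hm⟩ := hV
  obtain ⟨T, hXT, -, hT⟩ := exists_subsuperset_card_eq (n := m) (subset_univ X) (by omega)
    (by rw [card_univ]; omega)
  have hTc : #Tᶜ = m := by rw [card_compl]; omega
  let e : T ≃ (Tᶜ : Finset V) := equivOfCardEq (hT.trans hTc.symm)
  let f : V → V := fun v ↦
    if h : v ∈ T then e ⟨v, h⟩ else e.symm ⟨v, mem_compl.2 h⟩
  have hf_pos (v : V) (h : v ∈ T) : f v = e ⟨v, h⟩ := dif_pos h
  have hf_neg (v : V) (h : v ∉ T) : f v = e.symm ⟨v, mem_compl.2 h⟩ := dif_neg h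
  have hf_not_mem (v : V) (h : v ∈ T) : f v ∉ T := by
    rw [hf_pos v h]
    exact mem_compl.1 (e ⟨v, h⟩).2
  have hf_mem (v : V) (h : v ∉ T) : f v ∈ T := by
    rw [hf_neg v h]
    exact (e.symm ⟨v, mem_compl.2 h⟩).2
  have hinv : Function.Involutive f := by
    intro v
    by_cases h : v ∈ T
    · rw [hf_neg _ (hf_not_mem v h)]
      simp [hf_pos v h]
    · rw [hf_pos _ (hf_mem v h)]
      simp [hf_neg v h]
  have hne (v : V) : f v ≠ v := by
    intro hv
    by_cases h : v ∈ T
    · exact hf_not_mem v h (hv.symm ▸ h)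
    · exact h (hv ▸ hf_mem v h)
  obtain ⟨P, -, hdisj⟩ := hP f hinv hne
  have hfX (v : V) (hv : v ∈ X) : f v ∉ X := fun h ↦ hf_not_mem v (hXT hv) (hXT h)
  have hcross (v : V) : ∃ p : V × V, v ∈ X → p ∈ A ×ˢ B ∧ s(p.1, p.2) ∈ (P v).edges := by
    by_cases hv : v ∈ X
    · obtain ⟨d, hd, h₁, h₂⟩ := (P v).exists_boundary_dart (X : Set V) hv (hfX v hv)
      exact ⟨d.toProd, fun _ ↦ ⟨mem_product.2 (hAB _ _ d.adj h₁ h₂), List.mem_map_of_mem hd⟩⟩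
    · exact ⟨(v, v), fun h ↦ absurd h hv⟩
  choose g hg using hcross
  rw [← card_product]
  refine card_le_card_of_injOn g (fun v hv ↦ (hg v hv).1) fun v hv w hw hvw ↦ ?_
  by_contra hne'
  refine hdisj v w (Ne.symm hne') (fun h ↦ hfX v hv (h ▸ hw)) _ (hg v hv).2 ?_
  rw [hvw]
  exact (hg w hw).2

theorem SimpleGraph.Adj.dist_le_add_one_of_dist_pos {V : Type*} {G : SimpleGraph V} {x a b : V}
    (hab : G.Adj a b) (hb : 0 < G.dist x b) : G.dist x b ≤ G.dist x a + 1 := by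
  have hxb : G.Reachable x b := by
    by_contra h
    rw [SimpleGraph.dist_eq_zero_of_not_reachable h] at hb
    exact hb.false
  obtain ⟨p, hp⟩ := (hxb.trans hab.symm.reachable).exists_walk_length_eq_dist
  simpa [hp] using SimpleGraph.dist_le (p.concat hab)

/-- Sequences whose increments satisfy `u i ≤ s i * s (i + 1)` grow quadratically. -/
theorem sq_le_four_mul_of_le_mul {u s : ℕ → ℕ} {k : ℕ} (h₀ : 0 < u 0) (hs₀ : s 0 = u 0)
    (hus : ∀ i, u (i + 1) = u i + s (i + 1)) (hmul : ∀ i ≤ k, u i ≤ s i * s (i + 1)) :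
    (k + 1) ^ 2 ≤ 4 * u k := by
  suffices h : ∀ i ≤ k, (i + 1) ^ 2 ≤ 4 * u i ∧ (i + 2) ^ 2 ≤ 4 * u (i + 1) from (h k le_rfl).1
  intro i
  induction i with
  | zero =>
    intro hi
    have h := hmul 0 hi
    have hs₁ : 0 < s 1 := by
      by_contra! hs
      simp [Nat.le_zero.1 hs] at h
      omega
    have := hus 0
    simp only [zero_add] at *
    omega
  | succ i ih =>
    intro hi
    obtain ⟨h₁, h₂⟩ := ih (by omega)
    have hmul' := hmul (i + 1) hi
    have hsum : i + 2 ≤ s (i + 1) + s (i + 2) := by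
      refine (Nat.pow_le_pow_iff_left two_ne_zero).1 (h₂.trans ?_)
      zify at hmul' ⊢
      nlinarith [sq_nonneg ((s (i + 1) : ℤ) - s (i + 2))]
    refine ⟨h₂, ?_⟩
    have e₁ := hus i
    have e₂ := hus (i + 1)
    nlinarith

open Finset in
theorem SimpleGraph.PathPairable.card_le_or_sq_le {V : Type*} [Fintype V] {G : SimpleGraph V}
    (hG : G.PathPairable) (x : V) (k : ℕ) :
    Fintype.card V ≤ 2 * {v : V | G.dist x v ≤ k}.ncard ∨
      (k + 1) ^ 2 ≤ 4 * {v : V | G.dist x v ≤ k}.ncard := by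
  classical
  let u : ℕ → ℕ := fun i ↦ #{v : V | G.dist x v ≤ i}
  let s : ℕ → ℕ := fun i ↦ #{v : V | G.dist x v = i}
  have hncard : {v : V | G.dist x v ≤ k}.ncard = u k := by
    simp [u, Set.ncard_eq_toFinset_card']
  rw [hncard, or_iff_not_imp_left, not_le]
  intro hk
  have hmono : Monotone u := fun i j hij ↦
    card_le_card (monotone_filter_right _ fun v _ (hv : G.dist x v ≤ i) ↦ hv.trans hij)
  refine sq_le_four_mul_of_le_mul (s := s) (card_pos.2 ⟨x, by simp⟩) (by simp [u, s]) ?_ ?_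
  · intro i
    rw [← card_union_of_disjoint]
    · refine congrArg card (Finset.ext fun v ↦ ?_)
      simp only [mem_filter, mem_univ, true_and, mem_union]
      omega
    · refine Finset.disjoint_left.2 fun v ↦ ?_
      simp only [mem_filter, mem_univ, true_and]
      omega
  · intro i hi
    refine hG.card_le_mul_card ((Nat.mul_le_mul_left 2 (hmono hi)).trans hk.le) ?_
    intro a b hab ha hb
    simp only [mem_filter, mem_univ, true_and] at ha hb ⊢
    have := hab.dist_le_add_one_of_dist_pos (x := x) (by omega)
    omega

/-- **Lemma 2.** If `G` is path-pairable on `n` vertices with diameter `d ≥ 20`, realized by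
vertices `x, y` with `dist x y = d`, then the set `A` of vertices at distance at most
`⌈d/3⌉` from `x` (in ℕ, `⌈d/3⌉ = (d+2)/3`) and the set `C` of vertices at distance at
most `⌈d/3⌉` from `y` both have size at least `min (n/2) (d²/100)`. -/
theorem near_sets_large {V : Type*} [Fintype V] {G : SimpleGraph V} {n d : ℕ}
    (hn : Fintype.card V = n) (hpp : G.PathPairable)
    (hdiam : G.diam = d) (hd : 20 ≤ d) (x y : V) (hxy : G.dist x y = d) :
    min ((n : ℝ) / 2) ((d : ℝ) ^ 2 / 100)
        ≤ ({v : V | G.dist x v ≤ (d + 2) / 3}.ncard : ℝ) ∧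
    min ((n : ℝ) / 2) ((d : ℝ) ^ 2 / 100)
        ≤ ({v : V | G.dist y v ≤ (d + 2) / 3}.ncard : ℝ) := by
  have key (z : V) : min ((n : ℝ) / 2) ((d : ℝ) ^ 2 / 100)
      ≤ ({v : V | G.dist z v ≤ (d + 2) / 3}.ncard : ℝ) := by
    rcases hpp.card_le_or_sq_le z ((d + 2) / 3) with h | h
    · refine min_le_of_left_le ?_
      rw [hn] at h
      have h' : (n : ℝ) ≤ 2 * ({v : V | G.dist z v ≤ (d + 2) / 3}.ncard : ℝ) := by
        exact_mod_cast h
      linarith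
    · refine min_le_of_right_le ?_
      have hdk : d ≤ 3 * ((d + 2) / 3 + 1) := by omega
      have hsq : d ^ 2 ≤ 36 * {v : V | G.dist z v ≤ (d + 2) / 3}.ncard := by
        have := Nat.pow_le_pow_left hdk 2
        rw [mul_pow] at this
        omega
      have h' : (d : ℝ) ^ 2 ≤ 36 * ({v : V | G.dist z v ≤ (d + 2) / 3}.ncard : ℝ) := by
        exact_mod_cast hsq
      linarith
  exact ⟨key x, key y⟩
end

section
/- Let G be a path-pairable simple graph on n vertices with diameter d ≥ 20, let x and y be vertices of G with d(x,y) = d, and let B be the set of vertices whose graph distance t from x satisfies ⌈d/3⌉ + 1 ≤ t ≤ ⌊2d/3⌋ − 1. Then |B| ≥ (d/6)·min(√n/√2, d/10). -/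
/-- If `S` contains at most half of the vertices of a path-pairable graph, and every edge leaving
`S` goes from `A` to `C`, then `|S| ≤ |A| * |C|`. -/
theorem SimpleGraph.PathPairable.card_le_mul_of_cut {V : Type*} [Fintype V] {G : SimpleGraph V}
    (hpp : G.PathPairable) (S A C : Finset V) (hS : 2 * S.card ≤ Fintype.card V)
    (hcut : ∀ a b, G.Adj a b → a ∈ S → b ∉ S → a ∈ A ∧ b ∈ C) :
    S.card ≤ A.card * C.card := by
  classical
  obtain ⟨heven, hpair⟩ := hpp
  rw [Nat.card_eq_fintype_card] at heven
  have hle : S.card + (Fintype.card V - S.card) = Fintype.card V := by omega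
  have hcompl : Fintype.card {v // v ∉ S} = Fintype.card V - S.card := by
    rw [Fintype.card_subtype_compl, Fintype.card_coe]
  let e : V ≃ Fin (Fintype.card V) :=
    (Equiv.sumCompl (· ∈ S)).symm.trans <|
      (Equiv.sumCongr S.equivFin (Fintype.equivFinOfCardEq hcompl)).trans <|
        finSumFinEquiv.trans (finCongr hle)
  have he : ∀ v ∈ S, (e v : ℕ) < S.card := by
    intro v hv
    simp [e, Equiv.sumCompl_symm_apply_of_pos hv]
  have he' : ∀ v, (e v : ℕ) < S.card → v ∈ S := by
    intro v hv
    by_contra hvS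
    simp [e, Equiv.sumCompl_symm_apply_of_neg hvS] at hv
  obtain ⟨P, -, hP⟩ := hpair (fun v => e.symm (e v).rev) (fun v => by simp) (fun v hv => by
    have h := congrArg (fun w => (e w : ℕ)) hv
    simp only [Equiv.apply_symm_apply, Fin.val_rev] at h
    obtain ⟨r, hr⟩ := heven
    have := (e v).isLt
    omega)
  have hfS : ∀ v ∈ S, e.symm (e v).rev ∉ S := by
    intro v hv hv'
    have h := he _ hv'
    have h' := he _ hv
    simp only [Equiv.apply_symm_apply, Fin.val_rev] at h
    omega
  have hdart : ∀ v : V, ∃ δ : G.Dart, v ∈ S →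
      δ ∈ (P v).darts ∧ δ.fst ∈ S ∧ δ.snd ∉ S := by
    intro v
    by_cases hv : v ∈ S
    · obtain ⟨δ, h₁, h₂, h₃⟩ := (P v).exists_boundary_dart (S : Set V) hv (hfS v hv)
      exact ⟨δ, fun _ => ⟨h₁, h₂, h₃⟩⟩
    · have hnn : ¬ (P v).Nil := by
        intro hnil
        have h := congrArg (fun w => (e w : ℕ)) hnil.eq
        simp only [Equiv.apply_symm_apply, Fin.val_rev] at h
        obtain ⟨r, hr⟩ := heven
        have := (e v).isLt
        omega
      exact ⟨(P v).firstDart hnn, fun h => absurd h hv⟩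
  choose δ hδ using hdart
  rw [← Finset.card_product]
  refine Finset.card_le_card_of_injOn (fun v => (δ v).toProd) ?_ ?_
  · intro v hv
    obtain ⟨-, h₂, h₃⟩ := hδ v hv
    simpa using hcut _ _ (δ v).adj h₂ h₃
  · intro v hv w hw hvw
    by_contra hne
    have hδvw : δ v = δ w := SimpleGraph.Dart.ext _ _ hvw
    refine hP v w (Ne.symm hne) (fun h => hfS v hv (h ▸ hw)) (δ v).edge
      (List.mem_map_of_mem (hδ v hv).1) ?_
    rw [hδvw]
    exact List.mem_map_of_mem (hδ w hw).1

/-- The sizes `u k` of the balls around a vertex of a path-pairable graph satisfy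
`4 * min (u (k + 1)) (n - u (k + 1)) ≤ (u (k + 2) - u k) ^ 2`. -/
theorem SimpleGraph.PathPairable.four_mul_min_ball_le {V : Type*} [Fintype V]
    {G : SimpleGraph V} (hpp : G.PathPairable) (hconn : G.Connected) (x : V) (k : ℕ) :
    4 * min (Finset.card {v | G.dist x v ≤ k + 1})
        (Fintype.card V - Finset.card {v | G.dist x v ≤ k + 1}) ≤
      (Finset.card {v | G.dist x v ≤ k + 2} - Finset.card {v | G.dist x v ≤ k}) ^ 2 := by
  classical
  set S : Finset V := {v | G.dist x v ≤ k + 1} with hS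
  set A : Finset V := {v | G.dist x v = k + 1} with hA
  set C : Finset V := {v | G.dist x v = k + 2} with hC
  have hcut : ∀ a b, G.Adj a b → a ∈ S → b ∉ S → a ∈ A ∧ b ∈ C := by
    intro a b hab ha hb
    have h := hconn.dist_triangle (u := x) (v := a) (w := b)
    rw [SimpleGraph.dist_eq_one_iff_adj.mpr hab] at h
    simp only [hS, hA, hC, Finset.mem_filter_univ] at ha hb ⊢
    omega
  have hSA : S.card = Finset.card {v | G.dist x v ≤ k} + A.card := by
    rw [← Finset.card_union_of_disjoint (by
      rw [Finset.disjoint_left]; intro v; simp only [hA, Finset.mem_filter_univ]; omega)]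
    congr 1
    ext v
    simp only [hS, hA, Finset.mem_union, Finset.mem_filter_univ]
    omega
  have hSC : Finset.card {v | G.dist x v ≤ k + 2} = S.card + C.card := by
    rw [← Finset.card_union_of_disjoint (by
      rw [Finset.disjoint_left]; intro v; simp only [hS, hC, Finset.mem_filter_univ]; omega)]
    congr 1
    ext v
    simp only [hS, hC, Finset.mem_union, Finset.mem_filter_univ]
    omega
  have hmin : min S.card (Fintype.card V - S.card) ≤ A.card * C.card := by
    by_cases h : 2 * S.card ≤ Fintype.card V
    · exact (min_le_left _ _).trans (hpp.card_le_mul_of_cut S A C h hcut)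
    · refine (min_le_right _ _).trans ?_
      rw [← Finset.card_compl, mul_comm]
      refine hpp.card_le_mul_of_cut Sᶜ C A (by rw [Finset.card_compl]; omega) ?_
      intro a b hab ha hb
      exact (hcut b a hab.symm (by simpa using hb) (by simpa using ha)).symm
  rw [show Finset.card {v | G.dist x v ≤ k + 2} - Finset.card {v | G.dist x v ≤ k} =
    A.card + C.card by omega]
  zify at hmin ⊢
  nlinarith [sq_nonneg ((A.card : ℤ) - C.card)]

/-- A monotone sequence whose two-step increments dominate `2 √u` grows quadratically until it
reaches `n / 2`. -/
theorem sq_le_four_mul_or_le_two_mul {u : ℕ → ℕ} {n K : ℕ} (hmono : Monotone u) (h0 : 1 ≤ u 0)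
    (hu : ∀ k, k + 2 ≤ K → 4 * min (u (k + 1)) (n - u (k + 1)) ≤ (u (k + 2) - u k) ^ 2) :
    ∀ k ≤ K, (k + 1) ^ 2 ≤ 4 * u k ∨ n ≤ 2 * u k := by
  intro k
  induction k using Nat.twoStepInduction with
  | zero => intro _; left; omega
  | one => intro _; left; have := hmono (zero_le_one' ℕ); omega
  | more k ih₁ ih₂ =>
    intro hk
    have h₁ := hmono (Nat.le_succ k)
    have h₂ := hmono (Nat.le_succ (k + 1))
    simp only [Nat.succ_eq_add_one, add_assoc, Nat.reduceAdd] at h₁ h₂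
    by_cases hn : n ≤ 2 * u (k + 2)
    · exact Or.inr hn
    have hk₁ := (ih₁ (by omega)).resolve_right (by omega)
    have hk₂ := (ih₂ (by omega)).resolve_right (by omega)
    have h := hu k hk
    rw [min_eq_left (by omega)] at h
    have hstep : k + 1 + 1 ≤ u (k + 2) - u k :=
      (Nat.pow_le_pow_iff_left two_ne_zero).mp (hk₂.trans h)
    left
    have : u k + (k + 2) ≤ u (k + 2) := by omega
    nlinarith

/-- The increment over the middle third of a sequence satisfying the growth conditions of the
ball sizes in a path-pairable graph. -/
theorem middle_third_increment {u : ℕ → ℕ} {n d : ℕ} (hd : 20 ≤ d) (hmono : Monotone u)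
    (h0 : 1 ≤ u 0) (hlast : u (d - 1) < n)
    (hu : ∀ k, 4 * min (u (k + 1)) (n - u (k + 1)) ≤ (u (k + 2) - u k) ^ 2) :
    (d : ℝ) / 6 * min (Real.sqrt n / Real.sqrt 2) ((d : ℝ) / 10) ≤
      (u (2 * d / 3 - 1) : ℝ) - u ((d + 2) / 3) := by
  set M : ℝ := min (Real.sqrt n / Real.sqrt 2) ((d : ℝ) / 10) with hM
  have hM0 : 0 ≤ M := le_min (by positivity) (by positivity)
  have hMn : 2 * M ^ 2 ≤ n := by
    have h : M ^ 2 ≤ (Real.sqrt n / Real.sqrt 2) ^ 2 :=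
      pow_le_pow_left₀ hM0 (min_le_left _ _) 2
    rw [div_pow, Real.sq_sqrt (by positivity), Real.sq_sqrt (by positivity)] at h
    linarith
  have hMd : M ≤ d / 10 := min_le_right _ _
  have hup := sq_le_four_mul_or_le_two_mul (K := d) hmono h0 (fun k _ => hu k)
  have hdown : ∀ k ≤ d - 1, (k + 1) ^ 2 ≤ 4 * (n - u (d - 1 - k)) ∨
      n ≤ 2 * (n - u (d - 1 - k)) := by
    refine sq_le_four_mul_or_le_two_mul (u := fun k => n - u (d - 1 - k)) (K := d - 1)
      ?_ ?_ ?_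
    · intro a b hab
      exact Nat.sub_le_sub_left (hmono (by omega)) n
    · simp only [tsub_zero]
      omega
    · intro k hk
      have h := hu (d - 1 - (k + 2))
      rw [show d - 1 - (k + 2) + 1 = d - 1 - (k + 1) by omega,
        show d - 1 - (k + 2) + 2 = d - 1 - k by omega] at h
      have h₁ := hmono (show d - 1 - (k + 1) ≤ d - 1 by omega)
      have h₂ := hmono (show d - 1 - k ≤ d - 1 by omega)
      have h₃ := hmono (show d - 1 - (k + 2) ≤ d - 1 - k by omega)
      rwa [min_comm, Nat.sub_sub_self (by omega),
        show n - u (d - 1 - (k + 2)) - (n - u (d - 1 - k)) =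
          u (d - 1 - k) - u (d - 1 - (k + 2)) by omega]
  have hbound : ∀ (j w : ℕ), d ≤ 3 * j → j ^ 2 ≤ 4 * w ∨ n ≤ 2 * w → M ^ 2 ≤ w := by
    rintro j w hj (h | h)
    · have hj' : (d : ℝ) ≤ 3 * j := mod_cast hj
      have h' : (j : ℝ) ^ 2 ≤ 4 * w := mod_cast h
      nlinarith
    · have h' : (n : ℝ) ≤ 2 * w := mod_cast h
      linarith
  have hstep : ∀ k, (d + 2) / 3 ≤ k → k + 2 ≤ 2 * d / 3 - 1 →
      (u k : ℝ) + 2 * M ≤ u (k + 2) := by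
    intro k hk₁ hk₂
    have hmin : M ^ 2 ≤ (min (u (k + 1)) (n - u (k + 1)) : ℕ) := by
      rw [Nat.cast_min]
      refine le_min (hbound (k + 2) _ (by omega) (hup (k + 1) (by omega))) ?_
      have h := hdown (d - 1 - (k + 1)) (by omega)
      rw [show d - 1 - (d - 1 - (k + 1)) = k + 1 by omega] at h
      exact hbound _ _ (by omega) h
    have h : (4 * (min (u (k + 1)) (n - u (k + 1)) : ℕ) : ℝ) ≤ ((u (k + 2) - u k : ℕ) : ℝ) ^ 2 :=
      mod_cast hu k
    rw [Nat.cast_sub (hmono (by omega))] at h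
    have hle : (u k : ℝ) ≤ u (k + 2) := mod_cast hmono (show k ≤ k + 2 by omega)
    have := le_of_sq_le_sq (show (2 * M) ^ 2 ≤ ((u (k + 2) : ℝ) - u k) ^ 2 by linarith)
      (by linarith)
    linarith
  have hiter : ∀ i, (d + 2) / 3 + 2 * i ≤ 2 * d / 3 - 1 →
      (u ((d + 2) / 3) : ℝ) + 2 * i * M ≤ u ((d + 2) / 3 + 2 * i) := by
    intro i
    induction i with
    | zero => simp
    | succ i ih =>
      intro hi
      have h₁ := ih (by omega)
      have h₂ := hstep ((d + 2) / 3 + 2 * i) (by omega) (by omega)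
      rw [show (d + 2) / 3 + 2 * (i + 1) = (d + 2) / 3 + 2 * i + 2 by ring]
      push_cast
      linarith
  set m := (2 * d / 3 - 1 - (d + 2) / 3) / 2 with hm
  have h₁ := hiter m (by omega)
  have h₂ : (u ((d + 2) / 3 + 2 * m) : ℝ) ≤ u (2 * d / 3 - 1) :=
    mod_cast hmono (by omega)
  have h₃ : (d : ℝ) ≤ 12 * m := by
    have : d ≤ 12 * m := by omega
    exact_mod_cast this
  have h₄ : (d : ℝ) / 6 * M ≤ 2 * m * M := by gcongr; linarith
  linarith

/-- **Middle-segment bound.** If `G` is path-pairable on `n` vertices with diameter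
`d ≥ 20`, realized by `dist x y = d`, then the set `B` of vertices at distance `t` from
`x` with `⌈d/3⌉ + 1 ≤ t ≤ ⌊2d/3⌋ - 1` (in ℕ, `⌈d/3⌉ = (d+2)/3` and `⌊2d/3⌋ = 2*d/3`)
satisfies `|B| ≥ (d/6)·min (√n/√2) (d/10)`. -/
theorem middle_segment_large {V : Type*} [Fintype V] {G : SimpleGraph V} {n d : ℕ}
    (hn : Fintype.card V = n) (hpp : G.PathPairable)
    (hdiam : G.diam = d) (hd : 20 ≤ d) (x y : V) (hxy : G.dist x y = d) :
    (d : ℝ) / 6 * min (Real.sqrt n / Real.sqrt 2) ((d : ℝ) / 10)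
      ≤ (({v : V | (d + 2) / 3 + 1 ≤ G.dist x v ∧ G.dist x v ≤ 2 * d / 3 - 1}.ncard : ℕ) : ℝ) := by
  classical
  have hconn : G.Connected := by
    have : Nonempty V := ⟨x⟩
    refine SimpleGraph.connected_of_ediam_ne_top (fun h => ?_)
    rw [SimpleGraph.diam, h] at hdiam
    simp at hdiam
    omega
  let u : ℕ → ℕ := fun k => Finset.card {v | G.dist x v ≤ k}
  have hmono : Monotone u := fun a b hab =>
    Finset.card_le_card (fun v => by simp only [Finset.mem_filter_univ]; omega)
  have h0 : 1 ≤ u 0 := Finset.card_pos.mpr ⟨x, by simp⟩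
  have hlast : u (d - 1) < n := by
    rw [← hn]
    refine Finset.card_lt_univ_of_notMem (x := y) ?_
    simp only [Finset.mem_filter_univ]
    omega
  refine (middle_third_increment hd hmono h0 hlast fun k => ?_).trans ?_
  · rw [← hn]
    exact hpp.four_mul_min_ball_le hconn x k
  · rw [sub_le_iff_le_add]
    have hB : {v : V | (d + 2) / 3 + 1 ≤ G.dist x v ∧ G.dist x v ≤ 2 * d / 3 - 1} =
        (({v | (d + 2) / 3 + 1 ≤ G.dist x v ∧ G.dist x v ≤ 2 * d / 3 - 1} : Finset V) : Set V) := by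
      ext v; simp
    rw [hB, Set.ncard_coe_finset]
    norm_cast
    refine le_trans (Finset.card_le_card fun v => ?_) (Finset.card_union_le _ _)
    simp only [Finset.mem_union, Finset.mem_filter_univ]
    omega
end

section
/- For every integer m ≥ 2, the blow-up of the cycle C_{2m} in which every vertex of the cycle is replaced by an independent set of 4m+3 vertices is path-pairable. Here the blow-up is the simple graph on vertex set V(C_{2m}) × {1, …, 4m+3} in which (u,i) and (v,j) are adjacent if and only if u and v are adjacent in C_{2m}. -/
open Classical in
/-- Greedy list colouring of the vertices satisfying `P`, where every other vertex `q` carries a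
set `F q` of at most two prescribed colours. -/
theorem SimpleGraph.exists_coloring_avoiding {ι C : Type*} [Fintype ι] [Fintype C] [Nonempty C]
    (R : SimpleGraph ι) (P : ι → Prop) (F : ι → Finset C) (hF : ∀ q, (F q).card ≤ 2)
    (hdeg : ∀ p, P p → 2 * (Finset.univ.filter (R.Adj p)).card < Fintype.card C)
    (hPF : ∀ q, P q → F q = ∅) :
    ∃ c : ι → C, ∀ p, P p → ∀ q, R.Adj p q → (P q → c p ≠ c q) ∧ c p ∉ F q := by
  suffices H : ∀ s : Finset ι, ∃ c : ι → C, ∀ p ∈ s, P p → ∀ q, R.Adj p q →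
      (q ∈ s → P q → c p ≠ c q) ∧ c p ∉ F q by
    obtain ⟨c, hc⟩ := H Finset.univ
    exact ⟨c, fun p hp q hpq => by simpa using hc p (Finset.mem_univ p) hp q hpq⟩
  intro s
  induction s using Finset.induction_on with
  | empty =>
    exact ⟨fun _ => Classical.arbitrary C, by simp⟩
  | insert a s ha ih =>
    obtain ⟨c, hc⟩ := ih
    by_cases hPa : P a
    · let B := (Finset.univ.filter (R.Adj a)).biUnion fun q => if P q then {c q} else F q
      have hB : B.card < Fintype.card C := by
        refine lt_of_le_of_lt (Finset.card_biUnion_le_card_mul _ _ 2 fun q _ => ?_)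
          (by have := hdeg a hPa; omega)
        split_ifs
        · simp
        · exact hF q
      obtain ⟨x, hx⟩ : ∃ x, x ∉ B := by
        by_contra! h
        exact hB.ne (by rw [Finset.eq_univ_iff_forall.2 h, Finset.card_univ])
      have hx' : ∀ q, R.Adj a q → (P q → x ≠ c q) ∧ x ∉ F q := by
        intro q hq
        have : x ∉ (if P q then {c q} else F q) := fun h =>
          hx (Finset.mem_biUnion.2 ⟨q, by simpa using hq, h⟩)
        by_cases hPq : P q
        · simp_all
        · simp_all
      refine ⟨Function.update c a x, fun p hp hPp q hpq => ?_⟩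
      by_cases hpa : p = a
      · subst hpa
        have hqp : q ≠ p := hpq.ne'
        simpa [hqp] using ⟨fun _ => (hx' q hpq).1, (hx' q hpq).2⟩
      · have hps : p ∈ s := by simpa [hpa] using hp
        by_cases hqa : q = a
        · subst hqa
          have := hx' p hpq.symm
          simpa [hpa] using ⟨fun _ => (this.1 hPp).symm, (hc p hps hPp q hpq).2⟩
        · simpa [hpa, hqa] using hc p hps hPp q hpq
    · refine ⟨c, fun p hp hPp q hpq => ?_⟩
      have hpa : p ≠ a := fun h => hPa (h ▸ hPp)
      have hps : p ∈ s := by simpa [hpa] using hp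
      refine ⟨fun hq hPq => (hc p hps hPp q hpq).1 ?_ hPq, (hc p hps hPp q hpq).2⟩
      have hqa : q ≠ a := fun h => hPa (h ▸ hPq)
      simpa [hqa] using hq

/-- The layers strictly inside a route from layer `i` to layer `j`, where `i ≤ j`: the layers
strictly between them or, if `i = j`, the layer matched with `i` in the perfect matching
`{0, 1}, {2, 3}, …` of the layers. -/
def InnerLayer (i j k : ℕ) : Prop :=
  (i < k ∧ k < j) ∨ (i = j ∧ ((i % 2 = 0 ∧ k = i + 1) ∨ (i % 2 = 1 ∧ k + 1 = i)))

/-- The vertices of a route from `x` to `y` which meets each inner layer `k` in position `h k`. -/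
def routeVerts {L N : ℕ} (x y : Fin L × Fin N) (h : Fin L → Fin N) : Set (Fin L × Fin N) :=
  {w | w = x ∨ w = y ∨ (InnerLayer x.1 y.1 w.1 ∧ w.2 = h w.1)}

/-- The route from `x` to `y` as a graph: vertices of the route in consecutive layers are
adjacent. -/
def routeGraph {L N : ℕ} (x y : Fin L × Fin N) (h : Fin L → Fin N) :
    SimpleGraph (Fin L × Fin N) where
  Adj a b := a ∈ routeVerts x y h ∧ b ∈ routeVerts x y h ∧
    ((a.1 : ℕ) + 1 = b.1 ∨ (b.1 : ℕ) + 1 = a.1)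
  symm := ⟨fun _ _ h => ⟨h.2.1, h.1, h.2.2.symm⟩⟩
  loopless := ⟨fun a h => by have := h.2.2; omega⟩

theorem routeGraph_le {L N : ℕ} (x y : Fin L × Fin N) (h : Fin L → Fin N) :
    routeGraph x y h ≤ SimpleGraph.comap Prod.fst (SimpleGraph.cycleGraph L) := by
  intro a b hab
  have h1 := hab.2.2
  have ha := a.1.isLt
  have hb := b.1.isLt
  rw [SimpleGraph.comap_adj, SimpleGraph.cycleGraph_adj']
  rcases h1 with h1 | h1
  · right
    rw [Fin.sub_def]
    simp only
    rw [show L - (a.1 : ℕ) + b.1 = 1 + L by omega, Nat.add_mod_right, Nat.mod_eq_of_lt (by omega)]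
  · left
    rw [Fin.sub_def]
    simp only
    rw [show L - (b.1 : ℕ) + a.1 = 1 + L by omega, Nat.add_mod_right, Nat.mod_eq_of_lt (by omega)]

theorem routeGraph_reachable {L N : ℕ} (hL : Even L) (x y : Fin L × Fin N)
    (h : Fin L → Fin N) (hxy : x.1 ≤ y.1) : (routeGraph x y h).Reachable x y := by
  have hx : x ∈ routeVerts x y h := Or.inl rfl
  have hy : y ∈ routeVerts x y h := Or.inr (Or.inl rfl)
  have hyL := y.1.isLt
  rcases hxy.eq_or_lt with heq | hlt
  · have heq' : (x.1 : ℕ) = y.1 := congrArg Fin.val heq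
    obtain ⟨k, hk⟩ : ∃ k : Fin L, InnerLayer x.1 y.1 k := by
      obtain ⟨l, rfl⟩ := hL
      rcases Nat.mod_two_eq_zero_or_one x.1 with h0 | h1
      · exact ⟨⟨x.1 + 1, by omega⟩, Or.inr ⟨heq', Or.inl ⟨h0, rfl⟩⟩⟩
      · exact ⟨⟨x.1 - 1, by omega⟩, Or.inr ⟨heq', Or.inr ⟨h1, by simp only; omega⟩⟩⟩
    have hz : (k, h k) ∈ routeVerts x y h := Or.inr (Or.inr ⟨hk, rfl⟩)
    have hk' : (x.1 : ℕ) + 1 = k ∨ (k : ℕ) + 1 = x.1 := by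
      rcases hk with hk | hk <;> omega
    have h1 : (routeGraph x y h).Adj x (k, h k) := ⟨hx, hz, hk'⟩
    have h2 : (routeGraph x y h).Adj y (k, h k) := ⟨hy, hz, by simp only; omega⟩
    exact h1.reachable.trans h2.symm.reachable
  · have hlt' : (x.1 : ℕ) < y.1 := hlt
    have key : ∀ k, ∀ hk : (x.1 : ℕ) + 1 + k < y.1,
        (routeGraph x y h).Reachable x (⟨x.1 + 1 + k, by omega⟩, h ⟨x.1 + 1 + k, by omega⟩) := by
      intro k
      induction k with
      | zero =>
        intro hk
        refine SimpleGraph.Adj.reachable ⟨hx, Or.inr (Or.inr ⟨Or.inl ⟨?_, ?_⟩, rfl⟩), Or.inl rfl⟩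
        · simp
        · simpa using hk
      | succ k ih =>
        intro hk
        refine (ih (by omega)).trans (SimpleGraph.Adj.reachable
          ⟨Or.inr (Or.inr ⟨Or.inl ⟨?_, ?_⟩, rfl⟩), Or.inr (Or.inr ⟨Or.inl ⟨?_, ?_⟩, rfl⟩),
            Or.inl ?_⟩) <;> simp only <;> omega
    by_cases h1 : (x.1 : ℕ) + 1 = y.1
    · exact SimpleGraph.Adj.reachable ⟨hx, hy, Or.inl h1⟩
    · refine (key (y.1 - x.1 - 2) (by omega)).trans (SimpleGraph.Adj.reachable
        ⟨Or.inr (Or.inr ⟨Or.inl ⟨?_, ?_⟩, rfl⟩), hy, Or.inl ?_⟩) <;> simp only <;> omega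

/-- A map from `ι` whose fibres all have at most `d` elements. -/
theorem exists_balanced_map {ι : Type*} [Fintype ι] (d N : ℕ) (h : Fintype.card ι ≤ d * N) :
    ∃ g : ι → Fin N, ∀ c, (Finset.univ.filter fun p => g p = c).card ≤ d := by
  obtain ⟨φ⟩ : Nonempty (ι ↪ Fin d × Fin N) :=
    Function.Embedding.nonempty_of_card_le (by simpa using h)
  refine ⟨fun p => (φ p).2, fun c => ?_⟩
  have := Finset.card_le_card_of_injOn (s := Finset.univ.filter fun p => (φ p).2 = c)
    (t := (Finset.univ : Finset (Fin d))) (fun p => (φ p).1) (by simp) (by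
      intro p hp q hq hpq
      simp only [Finset.coe_filter, Finset.mem_univ, true_and, Set.mem_ofPred_eq] at hp hq
      exact φ.injective (Prod.ext hpq (hp.trans hq.symm)))
  simpa using this

/-- On a route, at most two vertices lie in layers next to a given inner layer. -/
theorem exists_pair_covering {L N : ℕ} (x y : Fin L × Fin N) (hxy : x.1 ≤ y.1) (h : Fin L → Fin N)
    (e : Fin L) (hin : InnerLayer x.1 y.1 e) :
    ∃ u w : Fin L × Fin N, u ∈ routeVerts x y h ∧ w ∈ routeVerts x y h ∧
      ∀ a ∈ routeVerts x y h, ((a.1 : ℕ) + 1 = e ∨ (e : ℕ) + 1 = a.1) → a = u ∨ a = w := by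
  have hxy' : (x.1 : ℕ) ≤ y.1 := hxy
  have hyL := y.1.isLt
  rcases hin with ⟨h1, h2⟩ | ⟨h1, h2⟩
  · have uniq : ∀ a ∈ routeVerts x y h, ∀ b ∈ routeVerts x y h, (a.1 : ℕ) = b.1 → a = b := by
      have hne : (x.1 : ℕ) ≠ y.1 := by omega
      rintro a ha b hb hab
      have hab' : a.1 = b.1 := Fin.ext hab
      rcases ha with rfl | rfl | ⟨ha, ha'⟩ <;> rcases hb with rfl | rfl | ⟨hb, hb'⟩ <;>
        first
        | rfl
        | (exfalso; omega)
        | (exfalso; simp only [InnerLayer] at *; omega)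
        | exact Prod.ext hab' (by rw [ha', hb', hab'])
    have ex : ∀ k : ℕ, (x.1 : ℕ) ≤ k → k ≤ y.1 → ∃ a ∈ routeVerts x y h, (a.1 : ℕ) = k := by
      intro k hk1 hk2
      rcases hk1.eq_or_lt with hk | hk
      · exact ⟨x, Or.inl rfl, hk⟩
      rcases hk2.eq_or_lt with hk' | hk'
      · exact ⟨y, Or.inr (Or.inl rfl), hk'.symm⟩
      · exact ⟨(⟨k, by omega⟩, h ⟨k, by omega⟩), Or.inr (Or.inr ⟨Or.inl ⟨hk, hk'⟩, rfl⟩), rfl⟩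
    obtain ⟨u, hu, hu'⟩ := ex (e - 1) (by omega) (by omega)
    obtain ⟨w, hw, hw'⟩ := ex (e + 1) (by omega) (by omega)
    refine ⟨u, w, hu, hw, fun a ha hae => ?_⟩
    rcases hae with hae | hae
    · exact Or.inl (uniq a ha u hu (by omega))
    · exact Or.inr (uniq a ha w hw (by omega))
  · refine ⟨x, y, Or.inl rfl, Or.inr (Or.inl rfl), fun a ha hae => ?_⟩
    rcases ha with rfl | rfl | ⟨ha, -⟩
    · exact Or.inl rfl
    · exact Or.inr rfl
    · exfalso
      simp only [InnerLayer] at ha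
      omega

open Classical in
/-- Simultaneous edge-disjoint routing in a blow-up of a path. -/
theorem exists_disjoint_routes {ι : Type*} [Fintype ι] {L N d : ℕ}
    (hN : 4 * d < N) (hι : Fintype.card ι ≤ d * N) (x y : ι → Fin L × Fin N)
    (hxy : ∀ p, (x p).1 ≤ (y p).1)
    (hdisj : ∀ p q w, (w = x p ∨ w = y p) → (w = x q ∨ w = y q) → p = q) :
    ∃ h : ι → Fin L → Fin N, ∀ p q a b, (routeGraph (x p) (y p) (h p)).Adj a b →
      (routeGraph (x q) (y q) (h q)).Adj a b → p = q := by
  obtain ⟨g, hg⟩ := exists_balanced_map d N hι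
  let T : ι → Set (Fin L × Fin N) := fun p => routeVerts (x p) (y p) fun _ => g p
  have hT : ∀ a, (Finset.univ.filter fun q => a ∈ T q).card ≤ d + 1 := by
    intro a
    have hsub : (Finset.univ.filter fun q => a ∈ T q) ⊆
        (Finset.univ.filter fun q => g q = a.2) ∪
          Finset.univ.filter fun q => a = x q ∨ a = y q := by
      intro q hq
      simp only [Finset.mem_filter, Finset.mem_univ, true_and, Finset.mem_union] at hq ⊢
      rcases hq with hq | hq | hq
      · exact Or.inr (Or.inl hq)
      · exact Or.inr (Or.inr hq)
      · exact Or.inl hq.2.symm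
    have h1 : (Finset.univ.filter fun q => a = x q ∨ a = y q).card ≤ 1 := by
      refine Finset.card_le_one.2 fun p hp q hq => hdisj p q a ?_ ?_
      · simpa using hp
      · simpa using hq
    have := Finset.card_le_card hsub
    have := Finset.card_union_le (Finset.univ.filter fun q => g q = a.2)
      (Finset.univ.filter fun q => a = x q ∨ a = y q)
    have := hg a.2
    omega
  have : Nonempty (Fin N) := ⟨⟨0, by omega⟩⟩
  have col : ∀ e : Fin L, ∃ c : ι → Fin N, ∀ p, InnerLayer (x p).1 (y p).1 e →
      ∀ q a, p ≠ q → a ∈ T p → a ∈ T q → ((a.1 : ℕ) + 1 = e ∨ (e : ℕ) + 1 = a.1) →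
        (InnerLayer (x q).1 (y q).1 e → c p ≠ c q) ∧ (e, c p) ≠ x q ∧ (e, c p) ≠ y q := by
    intro e
    let R : SimpleGraph ι :=
      { Adj := fun p q => p ≠ q ∧ ∃ a, a ∈ T p ∧ a ∈ T q ∧
          ((a.1 : ℕ) + 1 = e ∨ (e : ℕ) + 1 = a.1)
        symm := ⟨fun p q ⟨h, a, h1, h2, h3⟩ => ⟨h.symm, a, h2, h1, h3⟩⟩
        loopless := ⟨fun p h => h.1 rfl⟩ }
    let F : ι → Finset (Fin N) := fun q =>
      (({x q, y q} : Finset (Fin L × Fin N)).filter fun w => w.1 = e).image Prod.snd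
    obtain ⟨c, hc⟩ := R.exists_coloring_avoiding (fun p => InnerLayer (x p).1 (y p).1 e) F
      (fun q => Finset.card_image_le.trans ((Finset.card_filter_le _ _).trans Finset.card_le_two))
      (fun p hp => by
        obtain ⟨u, w, hu, hw, huw⟩ :=
          exists_pair_covering (x p) (y p) (hxy p) (fun _ => g p) e hp
        have hsub : Finset.univ.filter (R.Adj p) ⊆
            ((Finset.univ.filter fun q => u ∈ T q).erase p) ∪
              ((Finset.univ.filter fun q => w ∈ T q).erase p) := by
          intro q hq
          simp only [Finset.mem_filter, Finset.mem_univ, true_and, Finset.mem_union,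
            Finset.mem_erase] at hq ⊢
          obtain ⟨hpq, a, hap, haq, hae⟩ := hq
          rcases huw a hap hae with rfl | rfl
          · exact Or.inl ⟨hpq.symm, haq⟩
          · exact Or.inr ⟨hpq.symm, haq⟩
        have h1 := Finset.card_le_card hsub
        have h2 := h1.trans (Finset.card_union_le _ _)
        rw [Finset.card_erase_of_mem (by simpa using hu),
          Finset.card_erase_of_mem (by simpa using hw)] at h2
        have := hT u
        have := hT w
        rw [Fintype.card_fin]
        have h3 : 2 * (Finset.univ.filter (R.Adj p)).card < N := by omega
        convert h3)
      (fun q hq => by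
        simp only [F, Finset.image_eq_empty, Finset.filter_eq_empty_iff, Finset.mem_insert,
          Finset.mem_singleton]
        rintro w (rfl | rfl) rfl <;> simp only [InnerLayer] at hq <;> omega)
    refine ⟨c, fun p hp q a hpq hap haq hae => ?_⟩
    obtain ⟨h1, h2⟩ := hc p hp q ⟨hpq, a, hap, haq, hae⟩
    refine ⟨h1, fun h => h2 ?_, fun h => h2 ?_⟩ <;>
      exact Finset.mem_image.2 ⟨(e, c p), Finset.mem_filter.2 ⟨by simp [h], rfl⟩, rfl⟩
  choose c hc using col
  let h : ι → Fin L → Fin N := fun p k => if (k : ℕ) % 2 = 0 then c k p else g p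
  have hodd : ∀ p a, (a.1 : ℕ) % 2 = 1 → a ∈ routeVerts (x p) (y p) (h p) → a ∈ T p := by
    rintro p a ha (h1 | h1 | h1)
    · exact Or.inl h1
    · exact Or.inr (Or.inl h1)
    · exact Or.inr (Or.inr (by simpa [h, ha] using h1))
  refine ⟨h, ?_⟩
  -- it suffices to treat adjacent vertices `a`, `b` with `a` in an odd and `b` in an even layer
  have key : ∀ p q a b, (a.1 : ℕ) % 2 = 1 → (b.1 : ℕ) % 2 = 0 →
      (routeGraph (x p) (y p) (h p)).Adj a b → (routeGraph (x q) (y q) (h q)).Adj a b →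
      p = q := by
    rintro p q a b ha hb ⟨hap, hbp, hab⟩ ⟨haq, hbq, -⟩
    by_contra hpq
    have hap' := hodd p a ha hap
    have haq' := hodd q a ha haq
    have e1 : InnerLayer (x p).1 (y p).1 b.1 ∧ b.2 = h p b.1 → b = (b.1, c b.1 p) :=
      fun h' => Prod.ext rfl (by simpa [h, hb] using h'.2)
    have e2 : InnerLayer (x q).1 (y q).1 b.1 ∧ b.2 = h q b.1 → b = (b.1, c b.1 q) :=
      fun h' => Prod.ext rfl (by simpa [h, hb] using h'.2)
    rcases or_assoc.2 hbp with hbp | hbp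
    · rcases or_assoc.2 hbq with hbq | hbq
      · exact hpq (hdisj p q b hbp hbq)
      · obtain ⟨-, h1, h2⟩ := hc b.1 q hbq.1 p a (Ne.symm hpq) haq' hap' hab
        rw [← e2 hbq] at h1 h2
        exact hbp.elim h1 h2
    · obtain ⟨h0, h1, h2⟩ := hc b.1 p hbp.1 q a hpq hap' haq' hab
      rw [← e1 hbp] at h1 h2
      rcases or_assoc.2 hbq with hbq | hbq
      · exact hbq.elim h1 h2
      · exact h0 hbq.1 (congrArg Prod.snd ((e1 hbp).symm.trans (e2 hbq)))
  intro p q a b hp hq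
  have hab := hp.2.2
  rcases Nat.mod_two_eq_zero_or_one a.1 with ha | ha
  · exact key p q b a (by omega) ha hp.symm hq.symm
  · exact key p q a b ha (by omega) hp hq

/-- The path-pairing condition, given for each pair a connecting subgraph such that these
subgraphs are edge-disjoint. -/
theorem SimpleGraph.exists_disjoint_paths {V ι : Type*} (G : SimpleGraph V) (f : V → V)
    (H : ι → SimpleGraph V) (hH : ∀ i, H i ≤ G) (r : V → ι)
    (hr : ∀ v, (H (r v)).Reachable v (f v)) (hrf : ∀ v w, r v = r w → w = v ∨ w = f v)
    (hdisj : ∀ i j a b, (H i).Adj a b → (H j).Adj a b → i = j) :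
    ∃ P : (v : V) → G.Walk v (f v), (∀ v, (P v).IsPath) ∧
      ∀ v w, w ≠ v → w ≠ f v → ∀ e ∈ (P v).edges, e ∉ (P w).edges := by
  choose Q hQ using fun v => (hr v).exists_isPath
  refine ⟨fun v => (Q v).mapLe (hH _), fun v => (hQ v).mapLe _, ?_⟩
  intro v w h1 h2 e hv hw
  rw [Walk.edges_mapLe_eq_edges] at hv hw
  induction e using Sym2.ind with
  | _ a b =>
    rcases hrf v w (hdisj _ _ a b ((Q v).adj_of_mem_edges hv) ((Q w).adj_of_mem_edges hw))
      with h | h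
    · exact h1 h
    · exact h2 h

/-- **Construction.** For every `m ≥ 2`, the blow-up of the cycle `C_{2m}` obtained by
replacing every vertex with an independent set of `4m+3` vertices (i.e. the comap of
`cycleGraph (2m)` along the first projection) is path-pairable. -/
theorem blowup_cycle_pathPairable (m : ℕ) (hm : 2 ≤ m) :
    (SimpleGraph.comap (Prod.fst : Fin (2 * m) × Fin (4 * m + 3) → Fin (2 * m))
      (SimpleGraph.cycleGraph (2 * m))).PathPairable := by
  classical
  refine ⟨by simp [mul_assoc], fun f hf hne => ?_⟩
  let V := Fin (2 * m) × Fin (4 * m + 3)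
  let ι := {v : V // toLex v < toLex (f v)}
  have hlt : ∀ v : V, ¬ toLex v < toLex (f v) → toLex (f v) < toLex (f (f v)) := fun v hv => by
    rw [hf v]
    exact lt_of_le_of_ne (not_lt.1 hv) fun h => hne v (toLex.injective h)
  have hdisj : ∀ p q : ι, ∀ w : V, (w = p.1 ∨ w = f p.1) → (w = q.1 ∨ w = f q.1) → p = q := by
    rintro ⟨p, hp⟩ ⟨q, hq⟩ w h1 h2
    refine Subtype.ext ?_
    rcases h1 with rfl | rfl <;> rcases h2 with h2 | h2
    · exact h2
    · subst h2
      rw [hf q] at hp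
      exact absurd hp hq.asymm
    · subst h2
      rw [hf p] at hq
      exact absurd hq hp.asymm
    · exact hf.injective h2
  have hcard : Fintype.card ι ≤ m * (4 * m + 3) := by
    have hinj : Function.Injective (Sum.elim (fun p : ι => p.1) fun p : ι => f p.1) := by
      refine Function.Injective.sumElim Subtype.val_injective
        (hf.injective.comp Subtype.val_injective) fun p q h => ?_
      have := hdisj p q p.1 (Or.inl rfl) (Or.inr h)
      subst this
      exact hne _ h.symm
    have := Fintype.card_le_of_injective _ hinj
    simp only [Fintype.card_sum, V, Fintype.card_prod, Fintype.card_fin] at this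
    nlinarith
  have hle : ∀ p : ι, p.1.1 ≤ (f p.1).1 := fun p => by
    rcases (Prod.Lex.toLex_lt_toLex).1 p.2 with h | h
    · exact h.le
    · exact h.1.le
  obtain ⟨h, hh⟩ := exists_disjoint_routes (by omega) hcard (fun p : ι => p.1) (fun p => f p.1)
    hle hdisj
  let r : V → ι := fun v => if hv : toLex v < toLex (f v) then ⟨v, hv⟩ else ⟨f v, hlt v hv⟩
  have hreach : ∀ p : ι, (routeGraph p.1 (f p.1) (h p)).Reachable p.1 (f p.1) := fun p =>
    routeGraph_reachable (even_two_mul m) _ _ _ (hle p)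
  have hr : ∀ v, (r v).1 = v ∨ (r v).1 = f v := fun v => by
    simp only [r]
    split_ifs <;> simp
  refine SimpleGraph.exists_disjoint_paths _ f (fun p : ι => routeGraph p.1 (f p.1) (h p))
    (fun p => routeGraph_le _ _ _) r (fun v => ?_) (fun v w hvw => ?_) hh
  · have h1 := hreach (r v)
    rcases hr v with hv | hv
    · generalize r v = p at *
      subst hv
      exact h1
    · have : f (r v).1 = v := by rw [hv, hf v]
      generalize r v = p at *
      subst this
      rw [hf p.1]
      exact h1.symm
  · have h1 := hr w
    rw [← hvw] at h1
    rcases hr v with hv | hv <;> rw [hv] at h1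
    · exact h1.imp Eq.symm fun h => by rw [h, hf w]
    · exact h1.symm.imp (fun h => (hf.injective h).symm) Eq.symm
end

section
/- For every integer m ≥ 2 there exists a path-pairable simple graph G on n = 2m(4m+3) vertices whose diameter exceeds √n/4. In particular, for infinitely many n the maximal diameter d_max(n) of a path-pairable graph on n vertices satisfies d_max(n) > √n/4. -/
/-- A fixed-point-free involution on `V` admits a labelling by elements of `L` that separates
its orbits as soon as `card V ≤ 2 * card L`. -/
theorem Function.Involutive.exists_orbit_separating {V L : Type*} [Fintype V] [Fintype L]
    {f : V → V} (hf : Function.Involutive f) (hne : ∀ v, f v ≠ v)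
    (hcard : Fintype.card V ≤ 2 * Fintype.card L) :
    ∃ φ : V → L, ∀ v w, φ v = φ w → w = v ∨ w = f v := by
  classical
  let e := Fintype.equivFin V
  let S : Finset V := Finset.univ.filter fun v => e v < e (f v)
  have hlt : ∀ v, v ∉ S → f v ∈ S := by
    intro v hv
    simp only [S, Finset.mem_filter, Finset.mem_univ, true_and, hf v, not_lt] at hv ⊢
    exact lt_of_le_of_ne hv fun h => hne v (e.injective h)
  have hle : S.card ≤ Sᶜ.card := by
    refine Finset.card_le_card_of_injOn f (fun v hv => ?_) hf.injective.injOn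
    simp only [S, Finset.coe_compl, Finset.coe_filter, Finset.mem_univ, true_and,
      Set.mem_compl_iff, Set.mem_ofPred_eq, hf v, not_lt] at hv ⊢
    exact hv.le
  have hSL : Fintype.card S ≤ Fintype.card L := by
    rw [Fintype.card_coe]
    have := Finset.card_add_card_compl S
    omega
  obtain ⟨g⟩ := Function.Embedding.nonempty_of_card_le hSL
  refine ⟨fun v => if h : v ∈ S then g ⟨v, h⟩ else g ⟨f v, hlt v h⟩, fun v w h => ?_⟩
  dsimp only at h
  split_ifs at h <;> simp only [EmbeddingLike.apply_eq_iff_eq, Subtype.mk.injEq] at h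
  · exact .inl h.symm
  · right; rw [h, hf w]
  · exact .inr h.symm
  · exact .inl (hf.injective h.symm)

namespace SimpleGraph

/-- If the two ends of every pair are connected in a subgraph attached to the pair, and subgraphs
attached to distinct pairs are disjoint, then there are edge-disjoint paths joining the pairs. -/
theorem exists_edgeDisjoint_paths_of_reachable {V : Type*} {G : SimpleGraph V} {f : V → V}
    (H : V → SimpleGraph V) (hle : ∀ v, H v ≤ G) (hreach : ∀ v, (H v).Reachable v (f v))
    (hdisj : ∀ v w, w ≠ v → w ≠ f v → ∀ x y, (H v).Adj x y → ¬ (H w).Adj x y) :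
    ∃ P : (v : V) → G.Walk v (f v), (∀ v, (P v).IsPath) ∧
      ∀ v w, w ≠ v → w ≠ f v → ∀ e ∈ (P v).edges, e ∉ (P w).edges := by
  choose P hP using fun v => (hreach v).exists_isPath
  refine ⟨fun v => (P v).mapLe (hle v), fun v => (hP v).mapLe (hle v), ?_⟩
  intro v w h1 h2 e
  induction e with | _ x y
  rw [Walk.edges_mapLe_eq_edges, Walk.edges_mapLe_eq_edges]
  exact fun hx hy => hdisj v w h1 h2 x y ((P v).adj_of_mem_edges hx) ((P w).adj_of_mem_edges hy)

/-- A function that changes by at most one along edges is `1`-Lipschitz along walks. -/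
theorem Walk.le_add_length_of_adj {V : Type*} {G : SimpleGraph V} (φ : V → ℕ)
    (hφ : ∀ x y, G.Adj x y → φ y ≤ φ x + 1) {u v : V} (p : G.Walk u v) :
    φ v ≤ φ u + p.length := by
  induction p with
  | nil => simp
  | cons h p ih =>
    have := hφ _ _ h
    rw [Walk.length_cons]
    omega

/-- The vertices of the layered hub graph: each of the `d` layers has three parts of `t` hubs,
and there are `r` further vertices. -/
abbrev HubVertex (d t r : ℕ) : Type := (Fin d × ZMod 3 × Fin t) ⊕ Fin r

namespace HubVertex

variable {d t r : ℕ}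

/-- The layer of a vertex; all vertices that are not hubs belong to the first layer. -/
def layer [NeZero d] : HubVertex d t r → Fin d
  | .inl x => x.1
  | .inr _ => 0

/-- The part of a vertex inside its layer. -/
def part : HubVertex d t r → ZMod 3
  | .inl x => x.2.1
  | .inr _ => 0

/-- The hub in layer `l` and part `c` reserved for the label `p`; its position inside the part
alternates between the two coordinates of `p`. -/
def hub (r : ℕ) (p : Fin t × Fin t) (l : Fin d) (c : ZMod 3) : HubVertex d t r :=
  .inl (l, c, if Even (l : ℕ) then p.1 else p.2)

/-- The hub through which the vertex `x` enters the system of hubs reserved for `p`. -/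
def entry [NeZero d] (p : Fin t × Fin t) (x : HubVertex d t r) : HubVertex d t r :=
  hub r p x.layer (x.part + 1)

@[simp] theorem layer_hub [NeZero d] (p : Fin t × Fin t) (l : Fin d) (c : ZMod 3) :
    (hub r p l c).layer = l := rfl

@[simp] theorem part_entry [NeZero d] (p : Fin t × Fin t) (x : HubVertex d t r) :
    (entry p x).part = x.part + 1 := rfl

theorem entry_ne_self [NeZero d] (p : Fin t × Fin t) (x : HubVertex d t r) : entry p x ≠ x :=
  fun h => by simpa using congrArg part h

/-- Entering the hubs never goes along the same edge in both directions. -/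
theorem entry_ne_of_entry_eq [NeZero d] {p q : Fin t × Fin t} {x y : HubVertex d t r}
    (h : entry p x = y) : entry q y ≠ x := by
  rintro rfl
  have h2 := congrArg part h
  simp only [part_entry, add_assoc, add_eq_left] at h2
  exact absurd h2 (by decide)

/-- Hubs in consecutive layers determine the label they are reserved for. -/
theorem label_eq_of_hub_eq {p q : Fin t × Fin t} {l l' k k' : Fin d} {c c' e e' : ZMod 3}
    (hl : (l : ℕ) + 1 = l') (h : hub r p l c = hub r q k e)
    (h' : hub r p l' c' = hub r q k' e') : p = q := by
  simp only [hub, Sum.inl.injEq, Prod.mk.injEq] at h h'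
  obtain ⟨rfl, -, h⟩ := h
  obtain ⟨rfl, -, h'⟩ := h'
  rw [← hl] at h'
  by_cases hev : Even (l : ℕ)
  · have hodd : ¬ Even ((l : ℕ) + 1) := by simpa [Nat.even_add_one] using hev
    simp only [hev, hodd, if_true, if_false] at h h'
    exact Prod.ext h h'
  · have heven : Even ((l : ℕ) + 1) := by simpa [Nat.even_add_one] using hev
    simp only [hev, heven, if_true, if_false] at h h'
    exact Prod.ext h' h

end HubVertex

open HubVertex

variable {d t r : ℕ}

/-- The hubs reserved for `p`, with all edges between consecutive layers. -/
def hubLadder (r : ℕ) (p : Fin t × Fin t) (x y : HubVertex d t r) : Prop :=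
  ∃ (l l' : Fin d) (c c' : ZMod 3), (l : ℕ) + 1 = l' ∧ x = hub r p l c ∧ y = hub r p l' c'

theorem hubLadder.label_eq {p q : Fin t × Fin t} {x y : HubVertex d t r}
    (h : hubLadder r p x y) (h' : hubLadder r q x y) : p = q := by
  obtain ⟨l, l', c, c', hl, rfl, rfl⟩ := h
  obtain ⟨k, k', e, e', -, h1, h2⟩ := h'
  exact label_eq_of_hub_eq hl h1 h2

variable [NeZero d]

/-- The layered hub graph: each layer is a clique, and any two hubs in consecutive layers are
adjacent. -/
def hubGraph (d t r : ℕ) [NeZero d] : SimpleGraph (HubVertex d t r) :=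
  fromRel fun x y => x.layer = y.layer ∨
    ∃ a b, x = .inl a ∧ y = .inl b ∧ (a.1 : ℕ) + 1 = b.1

/-- The edges of the layered hub graph reserved for joining `v` to `w`, using the label `p`. -/
def hubRoute (p : Fin t × Fin t) (v w : HubVertex d t r) : SimpleGraph (HubVertex d t r) :=
  fromRel fun x y => ((x = v ∨ x = w) ∧ y = entry p x) ∨
    (x = v ∧ y = w ∧ v.layer = w.layer) ∨ hubLadder r p x y

theorem hubRoute_le (p : Fin t × Fin t) (v w : HubVertex d t r) :
    hubRoute p v w ≤ hubGraph d t r := by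
  have hrel : ∀ x y, ((x = v ∨ x = w) ∧ y = entry p x) ∨ (x = v ∧ y = w ∧ v.layer = w.layer) ∨
      hubLadder r p x y → x.layer = y.layer ∨
        ∃ a b, x = .inl a ∧ y = .inl b ∧ (a.1 : ℕ) + 1 = b.1 := by
    rintro x y (⟨-, rfl⟩ | ⟨rfl, rfl, h⟩ | ⟨l, l', c, c', h, rfl, rfl⟩)
    · exact .inl rfl
    · exact .inl h
    · exact .inr ⟨_, _, rfl, rfl, h⟩
  exact fun x y h => ((fromRel_adj _ _ _).1 h).imp_right (Or.imp (hrel x y) (hrel y x))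

theorem hubRoute_reachable_hub (p : Fin t × Fin t) (v w : HubVertex d t r) {l l' : Fin d}
    (hl : l < l') (c c' : ZMod 3) :
    (hubRoute p v w).Reachable (hub r p l c) (hub r p l' c') := by
  have hstep : ∀ (k k' : Fin d) (e e' : ZMod 3), (k : ℕ) + 1 = k' →
      (hubRoute p v w).Adj (hub r p k e) (hub r p k' e') := by
    intro k k' e e' hk
    refine (fromRel_adj _ _ _).2 ⟨fun h => ?_, .inl (.inr (.inr ⟨k, k', e, e', hk, rfl, rfl⟩))⟩
    have := congrArg (fun x => ((layer x : Fin d) : ℕ)) h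
    simp only [layer_hub] at this
    omega
  obtain ⟨n, hn⟩ : ∃ n, (l' : ℕ) = l + 1 + n := Nat.exists_eq_add_of_le hl
  clear hl
  induction n generalizing l' c' with
  | zero => exact (hstep _ _ _ _ hn.symm).reachable
  | succ n ih =>
    have hk : (l : ℕ) + 1 + n < d := by omega
    exact (ih (l' := ⟨_, hk⟩) c' rfl).trans (hstep _ _ _ _ (by rw [hn]; rfl)).reachable

theorem hubRoute_reachable (p : Fin t × Fin t) (v w : HubVertex d t r) :
    (hubRoute p v w).Reachable v w := by
  by_cases hvw : v = w
  · rw [hvw]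
  by_cases hl : v.layer = w.layer
  · exact Adj.reachable ((fromRel_adj _ _ _).2 ⟨hvw, .inl (.inr (.inl ⟨rfl, rfl, hl⟩))⟩)
  have hv : (hubRoute p v w).Reachable v (entry p v) := Adj.reachable
    ((fromRel_adj _ _ _).2 ⟨(entry_ne_self p v).symm, .inl (.inl ⟨.inl rfl, rfl⟩)⟩)
  have hw : (hubRoute p v w).Reachable w (entry p w) := Adj.reachable
    ((fromRel_adj _ _ _).2 ⟨(entry_ne_self p w).symm, .inl (.inl ⟨.inr rfl, rfl⟩)⟩)
  refine hv.trans (Reachable.trans ?_ hw.symm)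
  rcases lt_or_gt_of_ne hl with h | h
  · exact hubRoute_reachable_hub p v w h _ _
  · exact (hubRoute_reachable_hub p v w h _ _).symm

theorem hubLadder.layer_eq {p : Fin t × Fin t} {x y : HubVertex d t r} (h : hubLadder r p x y) :
    (x.layer : ℕ) + 1 = y.layer := by
  obtain ⟨l, l', c, c', h, rfl, rfl⟩ := h
  exact h

/-- An edge of a route either stays in its layer and has an end in the pair, or is a ladder edge. -/
theorem hubRoute_adj_cases {p : Fin t × Fin t} {v v' x y : HubVertex d t r}
    (h : (hubRoute p v v').Adj x y) :
    (x.layer = y.layer ∧ (((x = v ∨ x = v') ∧ y = entry p x) ∨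
      ((y = v ∨ y = v') ∧ x = entry p y) ∨ ((x = v ∨ x = v') ∧ (y = v ∨ y = v')))) ∨
    hubLadder r p x y ∨ hubLadder r p y x := by
  obtain ⟨-, (⟨h, e⟩ | ⟨rfl, rfl, h⟩ | h) | (⟨h, e⟩ | ⟨rfl, rfl, h⟩ | h)⟩ :=
    (fromRel_adj _ _ _).1 h
  · exact .inl ⟨e ▸ rfl, .inl ⟨h, e⟩⟩
  · exact .inl ⟨h, .inr (.inr ⟨.inl rfl, .inr rfl⟩)⟩
  · exact .inr (.inl h)
  · exact .inl ⟨e ▸ rfl, .inr (.inl ⟨h, e⟩)⟩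
  · exact .inl ⟨h.symm, .inr (.inr ⟨.inr rfl, .inl rfl⟩)⟩
  · exact .inr (.inr h)

/-- Routes of disjoint pairs with distinct labels are edge-disjoint. -/
theorem hubRoute_not_adj {p q : Fin t × Fin t} (hpq : p ≠ q) {v v' w w' : HubVertex d t r}
    (h1 : w ≠ v) (h2 : w ≠ v') (h3 : w' ≠ v) (h4 : w' ≠ v') {x y : HubVertex d t r}
    (hx : (hubRoute p v v').Adj x y) : ¬ (hubRoute q w w').Adj x y := by
  have hdisj : ∀ z, (z = v ∨ z = v') → ¬ (z = w ∨ z = w') := by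
    rintro z (rfl | rfl) (rfl | rfl) <;> contradiction
  intro hy
  rcases hubRoute_adj_cases hx with ⟨hl, hx⟩ | hx | hx <;>
    rcases hubRoute_adj_cases hy with ⟨hl', hy⟩ | hy | hy
  · rcases hx with ⟨hx, hxy⟩ | ⟨hx, hxy⟩ | ⟨hx, hx'⟩ <;>
      rcases hy with ⟨hy, hyx⟩ | ⟨hy, hyx⟩ | ⟨hy, hy'⟩ <;>
      first
        | exact hdisj _ hx hy
        | exact hdisj _ hx hy'
        | exact hdisj _ hx' hy
        | exact entry_ne_of_entry_eq hxy.symm hyx.symm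
  all_goals first
    | exact hpq (hx.label_eq hy)
    | (have := congrArg Fin.val ‹layer x = layer y›
       have := hubLadder.layer_eq ‹_›
       omega)
    | (have := hx.layer_eq
       have := hy.layer_eq
       omega)

theorem hubGraph_connected (ht : 0 < t) : (hubGraph d t r).Connected where
  preconnected v w := (hubRoute_reachable (⟨0, ht⟩, ⟨0, ht⟩) v w).mono (hubRoute_le _ v w)
  nonempty := ⟨.inl (0, 0, ⟨0, ht⟩)⟩

theorem hubGraph_pathPairable (heven : Even (Fintype.card (HubVertex d t r)))
    (hcard : Fintype.card (HubVertex d t r) ≤ 2 * t ^ 2) : (hubGraph d t r).PathPairable := by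
  refine ⟨by rwa [Nat.card_eq_fintype_card], fun f hf hne => ?_⟩
  obtain ⟨φ, hinj⟩ := hf.exists_orbit_separating (L := Fin t × Fin t) hne
    (by simpa [sq] using hcard)
  refine exists_edgeDisjoint_paths_of_reachable (fun v => hubRoute (φ v) v (f v))
    (fun v => hubRoute_le _ _ _) (fun v => hubRoute_reachable _ _ _) fun v w h1 h2 x y hx => ?_
  refine hubRoute_not_adj (fun h => (hinj v w h).elim h1 h2) h1 h2 (fun h => h2 ?_)
    (fun h => h1 (hf.injective h)) hx
  rw [← h, hf w]

theorem le_diam_hubGraph (ht : 0 < t) (hr : 0 < r) : d ≤ (hubGraph d t r).diam := by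
  have hd : 0 < d := Nat.pos_of_ne_zero (NeZero.ne d)
  let u : HubVertex d t r := .inr ⟨0, hr⟩
  let v : HubVertex d t r := .inl (⟨d - 1, by omega⟩, 0, ⟨0, ht⟩)
  have hconn := hubGraph_connected (d := d) (r := r) ht
  have : Nonempty (HubVertex d t r) := ⟨u⟩
  refine le_trans ?_ (dist_le_diam (connected_iff_ediam_ne_top.1 hconn) (u := u) (v := v))
  obtain ⟨p, hp⟩ := hconn.exists_walk_length_eq_dist u v
  let height : HubVertex d t r → ℕ := Sum.elim (fun a => a.1 + 1) fun _ => 0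
  have hheight : ∀ x y, (hubGraph d t r).Adj x y → height y ≤ height x + 1 := by
    intro x y h
    obtain ⟨-, h⟩ := (fromRel_adj _ _ _).1 h
    rcases x with a | a <;> rcases y with b | b <;>
      simp only [layer, height, Fin.ext_iff, Sum.elim_inl, Sum.elim_inr] at h ⊢
    · grind
    · omega
    · grind
    · omega
  have := p.le_add_length_of_adj height hheight
  simp only [height, u, v, Sum.elim_inl, Sum.elim_inr] at this
  omega

end SimpleGraph

/-- For every `m ≥ 2` there is a path-pairable graph on `n = 2m(4m+3)` vertices with
diameter exceeding `√n / 4`; in particular, for infinitely many `n` there is a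
path-pairable graph on `n` vertices whose diameter exceeds `√n / 4`. -/
theorem pathPairable_large_diam :
    (∀ m : ℕ, 2 ≤ m → ∃ (V : Type) (_ : Fintype V) (G : SimpleGraph V),
        Fintype.card V = 2 * m * (4 * m + 3) ∧ G.PathPairable ∧
        Real.sqrt (2 * m * (4 * m + 3)) / 4 < (G.diam : ℝ)) ∧
    {n : ℕ | ∃ (V : Type) (_ : Fintype V) (G : SimpleGraph V),
        Fintype.card V = n ∧ G.PathPairable ∧
        Real.sqrt n / 4 < (G.diam : ℝ)}.Infinite := by
  have key : ∀ m : ℕ, 2 ≤ m → ∃ (V : Type) (_ : Fintype V) (G : SimpleGraph V),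
      Fintype.card V = 2 * m * (4 * m + 3) ∧ G.PathPairable ∧
      Real.sqrt (2 * m * (4 * m + 3)) / 4 < (G.diam : ℝ) := by
    intro m hm
    have : NeZero m := ⟨by omega⟩
    have hcard : Fintype.card (SimpleGraph.HubVertex m (2 * m + 1) (2 * m ^ 2 + 3 * m)) =
        2 * m * (4 * m + 3) := by
      simp only [Fintype.card_sum, Fintype.card_prod, Fintype.card_fin, ZMod.card]
      ring
    refine ⟨_, inferInstance, SimpleGraph.hubGraph m (2 * m + 1) (2 * m ^ 2 + 3 * m), hcard,
      SimpleGraph.hubGraph_pathPairable ?_ ?_, ?_⟩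
    · rw [hcard, mul_assoc]
      exact even_two_mul _
    · rw [hcard]
      nlinarith
    · have hdiam : (m : ℝ) ≤ (SimpleGraph.hubGraph m (2 * m + 1) (2 * m ^ 2 + 3 * m)).diam := by
        exact_mod_cast SimpleGraph.le_diam_hubGraph (by omega) (by positivity)
      refine lt_of_lt_of_le ?_ hdiam
      have hm' : (2 : ℝ) ≤ m := by exact_mod_cast hm
      rw [div_lt_iff₀ (by norm_num), Real.sqrt_lt' (by positivity)]
      nlinarith
  refine ⟨key, Set.infinite_of_injective_forall_mem
    (f := fun k : ℕ => 2 * (k + 2) * (4 * (k + 2) + 3)) ?_ fun k => ?_⟩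
  · refine StrictMono.injective fun a b hab => ?_
    gcongr
  · obtain ⟨V, hV, G, h1, h2, h3⟩ := key (k + 2) (by omega)
    exact ⟨V, hV, G, h1, h2, by exact_mod_cast h3⟩
end

section
/- Let a, b ≥ 1 be integers with a + b even, a ≠ 2 and b ≠ 2. Then the complete bipartite graph K_{a,b} is path-pairable. -/
/-- Edge-disjoint paths of length at most two: adjacent pairs use their edge, and every other pair
`{v, f v}` passes through the vertex `m v`. -/
theorem SimpleGraph.exists_edgeDisjoint_paths_of_midpoint {V : Type*} (G : SimpleGraph V)
    (f m : V → V) (hf : Function.Involutive f) (hne : ∀ v, f v ≠ v)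
    (hm : ∀ v, ¬ G.Adj v (f v) → G.Adj v (m v) ∧ G.Adj (m v) (f v))
    (hc : ∀ v w, ¬ G.Adj v (f v) → ¬ G.Adj w (f w) →
      (m v = w ∨ m v = f w) → (m w = v ∨ m w = f v) → False) :
    ∃ P : (v : V) → G.Walk v (f v),
      (∀ v, (P v).IsPath) ∧
      ∀ v w, w ≠ v → w ≠ f v → ∀ e ∈ (P v).edges, e ∉ (P w).edges := by
  have key : ∀ v, ∃ P : G.Walk v (f v), P.IsPath ∧ ∀ e ∈ P.edges,
      e = s(v, f v) ∨ (¬ G.Adj v (f v) ∧ (e = s(v, m v) ∨ e = s(f v, m v))) := by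
    intro v
    by_cases h : G.Adj v (f v)
    · exact ⟨.cons h .nil, by simp [h.ne], by simp⟩
    · obtain ⟨h₁, h₂⟩ := hm v h
      refine ⟨.cons h₁ (.cons h₂ .nil), by simp [h₁.ne, h₂.ne, (hne v).symm], ?_⟩
      intro e he
      simp only [SimpleGraph.Walk.edges_cons, SimpleGraph.Walk.edges_nil, List.mem_cons,
        List.not_mem_nil, or_false] at he
      rcases he with rfl | rfl
      · exact Or.inr ⟨h, Or.inl rfl⟩
      · exact Or.inr ⟨h, Or.inr Sym2.eq_swap⟩
  choose P hP hE using key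
  refine ⟨P, hP, fun v w hwv hwf e hev hew => ?_⟩
  have hfv := hf v
  have hfw := hf w
  have hc' := hc v w
  rcases hE v e hev with rfl | ⟨hv, rfl | rfl⟩ <;>
    rcases hE w _ hew with h | ⟨hw, h | h⟩ <;>
    rw [Sym2.eq_iff] at h <;> grind

/-- The complete bipartite graph `K_{a,b}` is path-pairable whenever `a + b` is even and
`a, b ≠ 2`. -/
theorem completeBipartite_pathPairable (a b : ℕ) (ha : 1 ≤ a) (hb : 1 ≤ b)
    (hab : Even (a + b)) (ha2 : a ≠ 2) (hb2 : b ≠ 2) :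
    (completeBipartiteGraph (Fin a) (Fin b)).PathPairable := by
  refine ⟨by simpa using hab, fun f hf hne => ?_⟩
  by_cases hcross : ∃ x y, f (Sum.inl x) = Sum.inr y
  · obtain ⟨x, y, hxy⟩ := hcross
    have hyx : f (Sum.inr y) = Sum.inl x := by rw [← hxy, hf]
    refine SimpleGraph.exists_edgeDisjoint_paths_of_midpoint _ f
      (Sum.elim (fun _ => Sum.inr y) (fun _ => Sum.inl x)) hf hne ?_ ?_
    · rintro (v | v) h <;> rcases hv : f _ with u | u <;> simp_all
    · have hfx : ∀ v, f v = Sum.inl x → v = Sum.inr y := fun v h => by rw [← hf v, h, hxy]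
      have hfy : ∀ v, f v = Sum.inr y → v = Sum.inl x := fun v h => by rw [← hf v, h, hyx]
      rintro (v | v) (w | w) hv hw (h₁ | h₁) (h₂ | h₂) <;> simp at h₁ h₂ <;>
        grind [completeBipartiteGraph_adj]
  · push Not at hcross
    have hl : ∀ x, ∃ x', f (Sum.inl x) = Sum.inl x' := by
      intro x
      rcases h : f (Sum.inl x) with x' | y
      · exact ⟨x', rfl⟩
      · exact absurd h (hcross x y)
    have hr : ∀ y, ∃ y', f (Sum.inr y) = Sum.inr y' := by
      intro y
      rcases h : f (Sum.inr y) with x | y'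
      · exact absurd (by rw [← h, hf]) (hcross x y)
      · exact ⟨y', rfl⟩
    choose g hg using hl
    choose k hk using hr
    have third : ∀ n : ℕ, 1 ≤ n → n ≠ 2 → ∀ g : Fin n → Fin n, (∀ i, g i ≠ i) →
        ∃ i j : Fin n, j ≠ i ∧ j ≠ g i := by
      intro n h₁ h₂ g hgi
      have h3 : 3 ≤ n := by
        have : n ≠ 1 := by
          rintro rfl
          exact hgi 0 (Subsingleton.elim _ _)
        omega
      obtain ⟨j, hj⟩ := Finset.exists_mem_notMem_of_card_lt_card
        (s := {(⟨0, by omega⟩ : Fin n), g ⟨0, by omega⟩}) (t := Finset.univ)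
        (by grw [Finset.card_le_two]; simp; omega)
      exact ⟨⟨0, by omega⟩, j, by simpa using hj⟩
    have hgg : ∀ x, g (g x) = x := fun x => by
      have := hf (Sum.inl x); simpa [hg] using this
    have hkk : ∀ y, k (k y) = y := fun y => by
      have := hf (Sum.inr y); simpa [hk] using this
    obtain ⟨p, p', hp₁, hp₂⟩ := third a ha ha2 g fun i h => hne (Sum.inl i) (by rw [hg, h])
    obtain ⟨q, q', hq₁, hq₂⟩ := third b hb hb2 k fun i h => hne (Sum.inr i) (by rw [hk, h])
    refine SimpleGraph.exists_edgeDisjoint_paths_of_midpoint _ f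
      (Sum.elim (fun x => Sum.inr (if x = p ∨ x = g p then q else q'))
        (fun y => Sum.inl (if y = q ∨ y = k q then p' else p))) hf hne ?_ ?_
    · rintro (v | v) - <;> simp [hg, hk]
    · rintro (v | v) (w | w) - - h₁ h₂ <;> simp [hg, hk] at h₁ h₂ <;> grind
end

section
/- If G is a path-pairable simple graph on n vertices with maximum degree Δ, then n ≤ 2·Δ^Δ. -/
open Finset in
/-- A graph on an even number of vertices with minimum degree at least half the number of vertices
has a perfect matching, here encoded as a fixed-point-free involution. -/
theorem SimpleGraph.exists_involutive_adj_of_card_le_two_mul_degree {V : Type*} [Fintype V]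
    (H : SimpleGraph V) [DecidableRel H.Adj] (heven : Even (Fintype.card V))
    (hdeg : ∀ v, Fintype.card V ≤ 2 * H.degree v) :
    ∃ f : V → V, Function.Involutive f ∧ ∀ v, H.Adj v (f v) := by
  classical
  obtain ⟨f, ⟨hf, hadj⟩, hmin⟩ := Set.exists_min_image
    {f : V → V | Function.Involutive f ∧ ∀ v, f v ≠ v → H.Adj v (f v)}
    (fun f ↦ #{v | f v = v}) (Set.toFinite _) ⟨id, fun _ ↦ rfl, fun _ h ↦ (h rfl).elim⟩
  refine ⟨f, hf, fun v ↦ hadj v fun hu ↦ ?_⟩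
  have key : ∀ g : V → V, Function.Involutive g → (∀ w, g w ≠ w → H.Adj w (g w)) →
      (∀ w, g w = w → f w = w) → g v = v := by
    intro g hg hgadj hsub
    by_contra hgv
    refine (hmin g ⟨hg, hgadj⟩).not_gt (card_lt_card ?_)
    refine (Finset.ssubset_iff_of_subset fun w ↦ by simpa using hsub w).2 ⟨v, by simpa using hu, ?_⟩
    simpa using hgv
  have hfix : ∀ x, f x = x → ¬ H.Adj v x := by
    intro x hx hvx
    have hne := hvx.ne
    have hsymm := hvx.symm
    refine hne.symm ?_
    have := key (fun w ↦ if w = v then x else if w = x then v else f w)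
      (fun w ↦ by have := hf w; grind) (fun w ↦ by have := hadj w; grind) (fun w ↦ by grind)
    simpa using this
  obtain ⟨y, hy, hyv⟩ : ∃ y, f y = y ∧ y ≠ v := by
    have hmod := Equiv.Perm.card_fixedPoints_modEq (f := f) (p := 2) (n := 1)
      (funext hf)
    by_contra! hcon
    have h1 : Fintype.card (Function.fixedPoints f) = 1 :=
      Fintype.card_eq_one_iff.2 ⟨⟨v, hu⟩, fun w ↦ Subtype.ext (hcon _ w.2)⟩
    rw [h1] at hmod
    rw [Nat.even_iff] at heven
    simp [Nat.ModEq, heven] at hmod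
  obtain ⟨x, hx⟩ : (H.neighborFinset v ∩ (H.neighborFinset y).image f).Nonempty := by
    by_contra hcon
    rw [not_nonempty_iff_eq_empty, ← disjoint_iff_inter_eq_empty] at hcon
    have hc := card_union_of_disjoint hcon
    rw [card_image_of_injective _ hf.injective, H.card_neighborFinset_eq_degree,
      H.card_neighborFinset_eq_degree] at hc
    have hsub : H.neighborFinset v ∪ (H.neighborFinset y).image f ⊆ univ.erase v := by
      intro w hw
      simp only [mem_union, mem_image, SimpleGraph.mem_neighborFinset] at hw
      simp only [mem_erase, mem_univ, and_true]
      rintro rfl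
      rcases hw with h | ⟨z, hz, rfl⟩
      · exact h.ne rfl
      · rw [hf z] at hu
        exact hfix y hy (hu ▸ hz.symm)
    have hle := card_le_card hsub
    rw [card_erase_of_mem (mem_univ v), card_univ] at hle
    have := hdeg v
    have := hdeg y
    have := Fintype.card_pos_iff.2 ⟨v⟩
    omega
  simp only [mem_inter, mem_image, SimpleGraph.mem_neighborFinset] at hx
  obtain ⟨hvx, z, hyz, rfl⟩ := hx
  have hz : f z ≠ z := fun h ↦ hfix (f z) ((hf z).trans h.symm) hvx
  have hvx' := hvx.symm
  have hyz' := hyz.symm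
  have hfz := hf z
  refine hvx.ne.symm ?_
  have := key (fun w ↦ if w = v then f z else if w = f z then v else
      if w = y then z else if w = z then y else f w)
    (fun w ↦ by have := hf w; grind) (fun w ↦ by have := hadj w; grind) (fun w ↦ by grind)
  simpa using this

/-- Every vertex at distance `i + 1` from `v` has a neighbour at distance `i` from `v`. -/
theorem SimpleGraph.exists_adj_edist_eq {V : Type*} (G : SimpleGraph V) {v w : V} {i : ℕ}
    (h : G.edist v w = (i + 1 : ℕ)) : ∃ u, G.Adj u w ∧ G.edist v u = i := by
  obtain ⟨p, hp⟩ := G.exists_walk_of_edist_ne_top (h ▸ ENat.natCast_ne_top _)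
  rw [h, Nat.cast_inj] at hp
  have hnil : ¬ p.Nil := by
    rw [← SimpleGraph.Walk.length_eq_zero_iff]
    omega
  have hadj := p.adj_penultimate hnil
  refine ⟨_, hadj, le_antisymm ?_ ?_⟩
  · refine (SimpleGraph.edist_le p.dropLast).trans ?_
    simp [SimpleGraph.Walk.length_dropLast, hp]
  · have htri := G.edist_triangle (u := v) (v := p.penultimate) (w := w)
    rw [h, SimpleGraph.edist_eq_one_iff_adj.2 hadj] at htri
    push_cast at htri
    exact (ENat.add_le_add_iff_right ENat.one_ne_top).1 htri

open Finset in
theorem SimpleGraph.card_filter_edist_eq_le {V : Type*} [Fintype V] [DecidableEq V]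
    (G : SimpleGraph V) [DecidableRel G.Adj] (v : V) (i : ℕ) :
    #{w | G.edist v w = (i + 1 : ℕ)} ≤ G.maxDegree * (G.maxDegree - 1) ^ i := by
  induction i with
  | zero =>
    refine (card_le_card fun w hw ↦ ?_).trans
      (((G.card_neighborFinset_eq_degree v).le.trans (G.degree_le_maxDegree v)).trans (by simp))
    simpa using hw
  | succ i ih =>
    rw [pow_succ, ← mul_assoc]
    refine le_trans (card_le_card (t := Finset.biUnion {u | G.edist v u = (i + 1 : ℕ)}
      fun u ↦ {w ∈ G.neighborFinset u | G.edist v w = (i + 1 + 1 : ℕ)}) fun w hw ↦ ?_)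
      ((card_biUnion_le_card_mul _ _ (G.maxDegree - 1) fun u hu ↦ ?_).trans
        (Nat.mul_le_mul_right _ ih))
    · simp only [mem_filter, mem_univ, true_and] at hw
      obtain ⟨u, hu, hd⟩ := G.exists_adj_edist_eq hw
      simp only [mem_biUnion, mem_filter, mem_univ, true_and, mem_neighborFinset]
      exact ⟨u, hd, hu, hw⟩
    · simp only [mem_filter, mem_univ, true_and] at hu
      obtain ⟨t, ht, hd⟩ := G.exists_adj_edist_eq hu
      have hsub : {w ∈ G.neighborFinset u | G.edist v w = (i + 1 + 1 : ℕ)} ⊆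
          (G.neighborFinset u).erase t := by
        intro w hw
        rw [mem_filter] at hw
        refine mem_erase.2 ⟨?_, hw.1⟩
        rintro rfl
        rw [hd, Nat.cast_inj] at hw
        omega
      refine (card_le_card hsub).trans ?_
      rw [card_erase_of_mem (by simpa using ht.symm), G.card_neighborFinset_eq_degree]
      exact Nat.sub_le_sub_right (G.degree_le_maxDegree u) 1

theorem Nat.sum_range_mul_pred_pow_le (n : ℕ) :
    ∑ i ∈ Finset.range n, n * (n - 1) ^ i ≤ n ^ n := by
  have key (d k : ℕ) : ∑ i ∈ Finset.range (k + 1), d ^ i ≤ (d + 1) ^ k := by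
    induction k with
    | zero => simp
    | succ k ih =>
      rw [Finset.sum_range_succ', pow_succ (d + 1)]
      simp only [pow_succ, ← Finset.sum_mul, pow_zero]
      nlinarith [Nat.one_le_pow k (d + 1) (by omega)]
  cases n with
  | zero => simp
  | succ d =>
    rw [← Finset.mul_sum, pow_succ', Nat.add_sub_cancel]
    exact Nat.mul_le_mul_left _ (key d d)

open Finset in
/-- At most `Δ ^ Δ` vertices other than `v` lie within distance `Δ` of `v`. -/
theorem SimpleGraph.card_filter_edist_le_maxDegree {V : Type*} [Fintype V] [DecidableEq V]
    (G : SimpleGraph V) [DecidableRel G.Adj] (v : V) :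
    #{w | w ≠ v ∧ G.edist v w ≤ G.maxDegree} ≤ G.maxDegree ^ G.maxDegree := by
  refine le_trans (card_le_card (t := (range G.maxDegree).biUnion
    fun i ↦ {w | G.edist v w = (i + 1 : ℕ)}) fun w hw ↦ ?_) (card_biUnion_le.trans
    ((sum_le_sum fun i _ ↦ G.card_filter_edist_eq_le v i).trans
      (Nat.sum_range_mul_pred_pow_le _)))
  simp only [mem_filter, mem_univ, true_and] at hw
  obtain ⟨hne, hle⟩ := hw
  obtain ⟨k, hk⟩ := ENat.ne_top_iff_exists.1 (ne_top_of_le_ne_top (ENat.natCast_ne_top _) hle)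
  have hk0 : k ≠ 0 := by
    rintro rfl
    exact hne (SimpleGraph.edist_eq_zero_iff.1 hk.symm).symm
  rw [← hk, Nat.cast_le] at hle
  simp only [mem_biUnion, mem_range, mem_filter, mem_univ, true_and]
  exact ⟨k - 1, by omega, by rw [← hk, Nat.sub_add_cancel (by omega)]⟩

open Finset in
/-- If paths joining the pairs of a pairing are edge-disjoint for distinct pairs, then the total
length of the paths, each pair being counted twice, is at most twice the number of edges. -/
theorem SimpleGraph.sum_length_le_two_mul_card_edgeFinset {V : Type*} [Fintype V]
    (G : SimpleGraph V) [DecidableRel G.Adj] {f : V → V} (P : (v : V) → G.Walk v (f v))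
    (hP : ∀ v, (P v).IsPath)
    (hdisj : ∀ v w, w ≠ v → w ≠ f v → ∀ e ∈ (P v).edges, e ∉ (P w).edges) :
    ∑ v, (P v).length ≤ 2 * #G.edgeFinset := by
  classical
  have hlen (v : V) : (P v).length = #{e ∈ G.edgeFinset | e ∈ (P v).edges} := by
    rw [← SimpleGraph.Walk.length_edges, ← List.toFinset_card_of_nodup (hP v).isTrail.edges_nodup]
    congr 1
    ext e
    simpa using fun h ↦ (P v).edges_subset_edgeSet h
  simp_rw [hlen]
  refine (sum_card_bipartiteAbove_eq_sum_card_bipartiteBelow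
    (fun v e ↦ e ∈ (P v).edges)).trans_le ?_
  rw [mul_comm, ← smul_eq_mul]
  refine sum_le_card_nsmul _ _ _ fun e _ ↦ ?_
  rcases (univ.bipartiteBelow (fun v e ↦ e ∈ (P v).edges) e).eq_empty_or_nonempty with h | ⟨v, hv⟩
  · simp [h]
  · refine (card_le_card (t := {v, f v}) fun w hw ↦ ?_).trans card_le_two
    simp only [mem_bipartiteBelow, mem_univ, true_and] at hv hw
    rw [mem_insert, mem_singleton]
    by_contra! hcon
    exact hdisj v w hcon.1 hcon.2 e hv hw

/-- If `G` is a path-pairable graph on `n` vertices with maximum degree `Δ`, then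
`n ≤ 2·Δ^Δ`. -/
theorem card_le_of_pathPairable {V : Type*} [Fintype V] {G : SimpleGraph V}
    [DecidableRel G.Adj] (hpp : G.PathPairable) :
    Fintype.card V ≤ 2 * G.maxDegree ^ G.maxDegree := by
  classical
  by_contra! hlt
  obtain ⟨heven, hpair⟩ := hpp
  rw [Nat.card_eq_fintype_card] at heven
  let H : SimpleGraph V :=
    { Adj := fun v w ↦ w ≠ v ∧ (G.maxDegree : ℕ∞) < G.edist v w
      symm := ⟨fun v w h ↦ ⟨h.1.symm, G.edist_comm ▸ h.2⟩⟩
      loopless := ⟨fun v h ↦ h.1 rfl⟩ }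
  have hdeg (v : V) : Fintype.card V ≤ 2 * H.degree v := by
    have hcov : (Finset.univ : Finset V) ⊆ insert v (H.neighborFinset v ∪
        ({w | w ≠ v ∧ G.edist v w ≤ G.maxDegree} : Finset V)) := by
      intro w _
      rcases eq_or_ne w v with rfl | hw
      · simp
      · rcases lt_or_ge (G.maxDegree : ℕ∞) (G.edist v w) with h | h <;>
          simp [H, hw, h]
    have hle := (Finset.card_le_card hcov).trans (Finset.card_insert_le _ _)
    have hunion := Finset.card_union_le (H.neighborFinset v)
      ({w | w ≠ v ∧ G.edist v w ≤ G.maxDegree} : Finset V)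
    rw [H.card_neighborFinset_eq_degree] at hunion
    have hball := G.card_filter_edist_le_maxDegree v
    rw [Finset.card_univ] at hle
    obtain ⟨m, hm⟩ := heven
    omega
  obtain ⟨f, hf, hadj⟩ := H.exists_involutive_adj_of_card_le_two_mul_degree heven hdeg
  obtain ⟨P, hP, hdisj⟩ := hpair f hf fun v ↦ (hadj v).1
  have hsum := G.sum_length_le_two_mul_card_edgeFinset P hP hdisj
  rw [← G.sum_degrees_eq_twice_card_edges] at hsum
  have : Nonempty V := Fintype.card_pos_iff.1 (by omega)
  refine hsum.not_gt (Finset.sum_lt_sum_of_nonempty Finset.univ_nonempty fun v _ ↦ ?_)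
  refine (G.degree_le_maxDegree v).trans_lt ?_
  exact_mod_cast (hadj v).2.trans_le (SimpleGraph.edist_le (P v))
end
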